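/- arXiv:1905.00362 — 6 statements merged into one kernel-verified Lean document; each statement's English description precedes it below -/
import Mathlib

section
/- Let α > 0, m > 0 and n be real numbers, let c̄ be a real number with 1 < c̄ < 2 such that Γ(c̄) ≤ Γ(x) for every x > 0 (i.e. c̄ is the point where the gamma function attains its minimum on the positive reals), and assume αn + 1 > c̄. Then for every complex number z with |z| < 1 one has |E_{α,m,n}(z)| ≤ 1/(1 − |z|). -/
open scoped BigOperators

/-- The Kilbas generalized Mittag-Leffler function
`E_{α,m,n}(z) = 1 + Σ_{k≥1} (∏_{j=0}^{k-1} Γ(α(jm+n)+1)/Γ(α(jm+n+1)+1)) z^k`. -/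
noncomputable def kilbasML (α m n : ℝ) (z : ℂ) : ℂ :=
  ∑' k : ℕ, ((∏ j ∈ Finset.range k,
      Real.Gamma (α * ((j : ℝ) * m + n) + 1) /
        Real.Gamma (α * ((j : ℝ) * m + n + 1) + 1) : ℝ) : ℂ) * z ^ k

/-- A convex function is nondecreasing to the right of a minimum point. -/
theorem ConvexOn.monotoneOn_inter_Ici_of_isMinOn {s : Set ℝ} {f : ℝ → ℝ} (hf : ConvexOn ℝ s f)
    {c : ℝ} (hc : c ∈ s) (hmin : IsMinOn f s c) : MonotoneOn f (s ∩ Set.Ici c) := by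
  intro x hx y hy hxy
  exact (hf.le_max_of_mem_Icc hc hy.1 ⟨hx.2, hxy⟩).trans
    (max_le (hmin hy.1) le_rfl)

/-- A power series with coefficients of norm at most one is bounded by the geometric series. -/
theorem norm_tsum_mul_pow_le {a : ℕ → ℂ} (ha : ∀ k, ‖a k‖ ≤ 1) {z : ℂ} (hz : ‖z‖ < 1) :
    ‖∑' k, a k * z ^ k‖ ≤ 1 / (1 - ‖z‖) := by
  rw [one_div]
  refine tsum_of_norm_bounded (hasSum_geometric_of_lt_one (norm_nonneg z) hz) fun k => ?_
  rw [norm_mul, norm_pow]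
  exact mul_le_of_le_one_left (by positivity) (ha k)

theorem kilbasML_norm_le (α m n cbar : ℝ) (hα : 0 < α) (hm : 0 < m)
    (hc1 : 1 < cbar) (hc2 : cbar < 2)
    (hmin : ∀ x : ℝ, 0 < x → Real.Gamma cbar ≤ Real.Gamma x)
    (hn : α * n + 1 > cbar)
    (z : ℂ) (hz : ‖z‖ < 1) :
    ‖kilbasML α m n z‖ ≤ 1 / (1 - ‖z‖) := by
  have hc0 : 0 < cbar := one_pos.trans hc1
  have hmono := Real.convexOn_Gamma.monotoneOn_inter_Ici_of_isMinOn hc0 fun x hx => hmin x hx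
  refine norm_tsum_mul_pow_le (fun k => ?_) hz
  have hlow : ∀ j : ℕ, cbar ≤ α * (j * m + n) + 1 := fun j => by
    have : 0 ≤ α * (j * m) := by positivity
    linarith
  have hstep : ∀ j : ℕ, α * (j * m + n) + 1 ≤ α * (j * m + n + 1) + 1 := fun j => by linarith
  have hnum : ∀ j : ℕ, 0 < Real.Gamma (α * (j * m + n) + 1) := fun j =>
    Real.Gamma_pos_of_pos (hc0.trans_le (hlow j))
  have hden : ∀ j : ℕ, 0 < Real.Gamma (α * (j * m + n + 1) + 1) := fun j =>
    Real.Gamma_pos_of_pos (hc0.trans_le ((hlow j).trans (hstep j)))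
  have hratio : ∀ j : ℕ,
      0 ≤ Real.Gamma (α * (j * m + n) + 1) / Real.Gamma (α * (j * m + n + 1) + 1) := fun j =>
    (div_pos (hnum j) (hden j)).le
  rw [Complex.norm_real, Real.norm_of_nonneg (Finset.prod_nonneg fun j _ => hratio j)]
  refine Finset.prod_le_one (fun j _ => hratio j) fun j _ => (div_le_one (hden j)).2 ?_
  exact hmono ⟨hc0.trans_le (hlow j), hlow j⟩
    ⟨hc0.trans_le ((hlow j).trans (hstep j)), (hlow j).trans (hstep j)⟩ (hstep j)
end

section
/- Let v : [−1,1] → ℝ be continuously differentiable and let n ≥ 1 be an integer. Then the n-th Fourier–Legendre coefficient of v satisfies |v_n| ≤ √2 · ‖v'‖ / (2n − 1)^{1/2}. -/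
open MeasureTheory

/-- The `n`-th Legendre polynomial via Rodrigues' formula
`P_n(x) = (1/(2^n n!)) dⁿ/dxⁿ (x²−1)ⁿ`. -/
noncomputable def legendreP (n : ℕ) (x : ℝ) : ℝ :=
  (1 / (2 ^ n * (Nat.factorial n : ℝ))) * iteratedDeriv n (fun y : ℝ => (y ^ 2 - 1) ^ n) x

/-- The `n`-th Fourier–Legendre coefficient `f_n = ((2n+1)/2) ∫_{−1}^1 f(x) P_n(x) dx`. -/
noncomputable def flCoeff (f : ℝ → ℝ) (n : ℕ) : ℝ :=
  ((2 * (n : ℝ) + 1) / 2) * ∫ x in (-1 : ℝ)..1, f x * legendreP n x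

/-- The L² norm of a function on `(−1,1)`: `‖g‖ = (∫_{−1}^1 g(x)² dx)^{1/2}`. -/
noncomputable def L2norm (g : ℝ → ℝ) : ℝ :=
  Real.sqrt (∫ x in (-1 : ℝ)..1, g x ^ 2)

open Polynomial

/-- Every derivative of `(X² - 1)ⁿ` of order less than `n` is divisible by `X² - 1`. -/
lemma X_sq_sub_one_dvd_iterate_derivative {n k : ℕ} (hk : k < n) :
    (X ^ 2 - 1 : ℝ[X]) ∣ derivative^[k] ((X ^ 2 - 1) ^ n) :=
  (dvd_pow_self _ (Nat.sub_ne_zero_of_lt hk)).trans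
    (pow_sub_dvd_iterate_derivative_of_pow_dvd k dvd_rfl)

lemma eval_eq_zero_of_X_sq_sub_one_dvd {p : ℝ[X]} (hp : X ^ 2 - 1 ∣ p) :
    p.eval 1 = 0 ∧ p.eval (-1) = 0 := by
  obtain ⟨q, rfl⟩ := hp
  simp

/-- Integration by parts on `[-1, 1]` against a polynomial vanishing at both end points. -/
lemma integral_mul_eval_derivative {p : ℝ[X]} (hp : X ^ 2 - 1 ∣ p) {u u' : ℝ → ℝ}
    (hu : ∀ x ∈ Set.Icc (-1 : ℝ) 1, HasDerivWithinAt u (u' x) (Set.Icc (-1) 1) x)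
    (hu' : ContinuousOn u' (Set.Icc (-1) 1)) :
    ∫ x in (-1 : ℝ)..1, u x * (derivative p).eval x = -∫ x in (-1 : ℝ)..1, u' x * p.eval x := by
  have huIcc : Set.uIcc (-1 : ℝ) 1 = Set.Icc (-1) 1 := Set.uIcc_of_le (by norm_num)
  obtain ⟨h1, h2⟩ := eval_eq_zero_of_X_sq_sub_one_dvd hp
  rw [intervalIntegral.integral_mul_deriv_eq_deriv_mul_of_hasDerivWithinAt
    (v := fun x => p.eval x) (u' := u') (by rwa [huIcc])
    (fun x _ => (p.hasDerivAt x).hasDerivWithinAt)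
    (ContinuousOn.intervalIntegrable (by rwa [huIcc]))
    ((derivative p).continuous.intervalIntegrable _ _)]
  simp [h1, h2]

lemma integral_eval_mul_eval_derivative {p : ℝ[X]} (hp : X ^ 2 - 1 ∣ p) (q : ℝ[X]) :
    ∫ x in (-1 : ℝ)..1, q.eval x * (derivative p).eval x =
      -∫ x in (-1 : ℝ)..1, (derivative q).eval x * p.eval x :=
  integral_mul_eval_derivative hp (fun x _ => (q.hasDerivAt x).hasDerivWithinAt)
    (derivative q).continuousOn

lemma integral_eval_mul_eval_iterate_derivative {n k : ℕ} (hk : k ≤ n) (q : ℝ[X]) :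
    ∫ x in (-1 : ℝ)..1, q.eval x * (derivative^[k] ((X ^ 2 - 1) ^ n)).eval x =
      (-1) ^ k * ∫ x in (-1 : ℝ)..1, (derivative^[k] q).eval x * (x ^ 2 - 1) ^ n := by
  induction k generalizing q with
  | zero => simp
  | succ k ih =>
    rw [Function.iterate_succ_apply',
      integral_eval_mul_eval_derivative (X_sq_sub_one_dvd_iterate_derivative hk),
      ih (Nat.le_of_succ_le hk), ← Function.iterate_succ_apply, pow_succ]
    ring

lemma integral_sq_mul_sq_sub_one_pow (m : ℕ) :
    2 * ((m : ℝ) + 1) * ∫ x in (-1 : ℝ)..1, x ^ 2 * (x ^ 2 - 1) ^ m =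
      -∫ x in (-1 : ℝ)..1, (x ^ 2 - 1) ^ (m + 1) := by
  have h := integral_eval_mul_eval_derivative
    (dvd_pow_self (X ^ 2 - 1 : ℝ[X]) m.succ_ne_zero) X
  simp only [derivative_pow, derivative_X, eval_X, eval_one, one_mul, eval_pow, eval_sub] at h
  rw [← h, ← intervalIntegral.integral_const_mul]
  congr 1 with x
  simp
  ring

lemma integral_sq_sub_one_pow_succ_eq_sub (m : ℕ) :
    ∫ x in (-1 : ℝ)..1, (x ^ 2 - 1) ^ (m + 1) =
      (∫ x in (-1 : ℝ)..1, x ^ 2 * (x ^ 2 - 1) ^ m) - ∫ x in (-1 : ℝ)..1, (x ^ 2 - 1) ^ m := by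
  rw [← intervalIntegral.integral_sub]
  · congr 1 with x
    ring
  all_goals exact Continuous.intervalIntegrable (by fun_prop) _ _

lemma integral_sq_sub_one_pow (m : ℕ) :
    ∫ x in (-1 : ℝ)..1, (x ^ 2 - 1) ^ m =
      (-1) ^ m * 2 ^ (2 * m + 1) * (m.factorial : ℝ) ^ 2 / (2 * m + 1).factorial := by
  induction m with
  | zero => norm_num
  | succ m ih =>
    have h1 := integral_sq_mul_sq_sub_one_pow m
    have h2 := integral_sq_sub_one_pow_succ_eq_sub m
    have h3 : (2 * (m : ℝ) + 3) * ∫ x in (-1 : ℝ)..1, (x ^ 2 - 1) ^ (m + 1) =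
        -(2 * (m + 1) * ∫ x in (-1 : ℝ)..1, (x ^ 2 - 1) ^ m) := by
      linear_combination 2 * ((m : ℝ) + 1) * h2 + h1
    rw [ih] at h3
    refine mul_left_cancel₀ (by positivity : 2 * (m : ℝ) + 3 ≠ 0) (h3.trans ?_)
    rw [show 2 * (m + 1) + 1 = 2 * m + 1 + 1 + 1 by ring, Nat.factorial_succ (2 * m + 1 + 1),
      Nat.factorial_succ (2 * m + 1), Nat.factorial_succ m]
    push_cast
    field_simp
    ring

lemma X_sq_sub_one_pow_succ_eq (m : ℕ) :
    ∃ r : ℝ[X], r.degree < (2 * m : ℕ) ∧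
      (X ^ 2 - 1 : ℝ[X]) ^ (m + 1) = X ^ (2 * m + 2) - ((m + 1 : ℕ) : ℝ[X]) * X ^ (2 * m) + r := by
  induction m with
  | zero => exact ⟨0, by simp⟩
  | succ m ih =>
    obtain ⟨r, hr, h⟩ := ih
    refine ⟨((m + 1 : ℕ) : ℝ[X]) * X ^ (2 * m) + (X ^ 2 - 1) * r, ?_, ?_⟩
    · refine (degree_add_le _ _).trans_lt (max_lt ?_ ?_)
      · rw [← C_eq_natCast]
        refine (degree_C_mul_X_pow_le _ _).trans_lt ?_
        exact_mod_cast (by omega : 2 * m < 2 * (m + 1))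
      · by_cases hr0 : r = 0
        · simp only [hr0, mul_zero, degree_zero]
          exact WithBot.bot_lt_coe _
        have hX : (X ^ 2 - 1 : ℝ[X]).natDegree ≤ 2 := by compute_degree
        rw [← natDegree_lt_iff_degree_lt hr0] at hr
        refine degree_le_natDegree.trans_lt ?_
        have := natDegree_mul_le (p := (X ^ 2 - 1 : ℝ[X])) (q := r)
        exact_mod_cast (by omega : ((X ^ 2 - 1 : ℝ[X]) * r).natDegree < 2 * (m + 1))
    · rw [pow_succ, h]
      push_cast
      ring

lemma eval_iterate_derivative_X_sq_sub_one_pow (m : ℕ) (x : ℝ) :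
    (derivative^[2 * m] ((X ^ 2 - 1 : ℝ[X]) ^ (m + 1))).eval x =
      (m + 1) * (2 * m).factorial * ((2 * m + 1) * x ^ 2 - 1) := by
  obtain ⟨r, hr, h⟩ := X_sq_sub_one_pow_succ_eq m
  have hd : ((2 * m + 2).descFactorial (2 * m) : ℝ) = (m + 1) * (2 * m + 1) * (2 * m).factorial := by
    have := Nat.factorial_mul_descFactorial (n := 2 * m + 2) (k := 2 * m) (by omega)
    rw [Nat.add_sub_cancel_left, Nat.factorial_succ, Nat.factorial_succ] at this
    have := congrArg (Nat.cast (R := ℝ)) this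
    push_cast [Nat.factorial] at this
    linarith
  rw [h, iterate_map_add, iterate_derivative_sub, iterate_derivative_natCast_mul,
    iterate_derivative_X_pow_eq_natCast_mul, iterate_derivative_X_pow_eq_natCast_mul,
    iterate_derivative_eq_zero_of_degree_lt hr]
  simp [hd, Nat.descFactorial_self]
  ring

lemma integral_sq_eval_iterate_derivative (m : ℕ) :
    ∫ x in (-1 : ℝ)..1, (derivative^[m] ((X ^ 2 - 1 : ℝ[X]) ^ (m + 1))).eval x ^ 2 =
      (2 ^ (m + 1) * (m + 1).factorial) ^ 2 * (4 / ((2 * m + 1) * (2 * m + 3) * (2 * m + 5))) := by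
  have h1 := integral_sq_mul_sq_sub_one_pow (m + 1)
  have h2 := integral_sq_sub_one_pow_succ_eq_sub (m + 1)
  have hI := integral_sq_sub_one_pow (m + 1)
  have hK : ∫ x in (-1 : ℝ)..1, x ^ 2 * (x ^ 2 - 1) ^ (m + 1) =
      (∫ x in (-1 : ℝ)..1, (x ^ 2 - 1) ^ (m + 1)) / (2 * (m : ℝ) + 5) := by
    rw [eq_div_iff (by positivity)]
    push_cast at h1
    linear_combination h1 - h2
  have hsplit : ∫ x in (-1 : ℝ)..1,
        ((m : ℝ) + 1) * (2 * m).factorial * ((2 * m + 1) * x ^ 2 - 1) * (x ^ 2 - 1) ^ (m + 1) =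
      ((m : ℝ) + 1) * (2 * m).factorial *
        ((2 * m + 1) * (∫ x in (-1 : ℝ)..1, x ^ 2 * (x ^ 2 - 1) ^ (m + 1)) -
          ∫ x in (-1 : ℝ)..1, (x ^ 2 - 1) ^ (m + 1)) := by
    rw [← intervalIntegral.integral_const_mul, ← intervalIntegral.integral_sub,
      ← intervalIntegral.integral_const_mul]
    · congr 1 with x
      ring
    all_goals exact Continuous.intervalIntegrable (by fun_prop) _ _
  simp_rw [sq (eval _ (derivative^[m] _))]
  rw [integral_eval_mul_eval_iterate_derivative m.le_succ, ← Function.iterate_add_apply,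
    ← two_mul]
  simp_rw [eval_iterate_derivative_X_sq_sub_one_pow]
  rw [hsplit, hK, hI, show 2 * (m + 1) + 1 = 2 * m + 1 + 1 + 1 by ring,
    Nat.factorial_succ (2 * m + 1 + 1), Nat.factorial_succ (2 * m + 1), Nat.factorial_succ (2 * m)]
  have hsign : ((-1 : ℝ) ^ m) ^ 2 = 1 := by rw [← pow_mul, mul_comm, pow_mul]; simp
  push_cast
  field_simp
  linear_combination 32 * ((m : ℝ) + 1) * (2 * m + 3) * 2 ^ (2 * m) * hsign

/-- The Cauchy–Schwarz inequality for continuous functions on an interval. -/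
lemma sq_intervalIntegral_mul_le {a b : ℝ} (hab : a ≤ b) {f g : ℝ → ℝ}
    (hf : ContinuousOn f (Set.Icc a b)) (hg : ContinuousOn g (Set.Icc a b)) :
    (∫ x in a..b, f x * g x) ^ 2 ≤ (∫ x in a..b, f x ^ 2) * ∫ x in a..b, g x ^ 2 := by
  rw [← Set.uIcc_of_le hab] at hf hg
  have hff : IntervalIntegrable (fun x => f x ^ 2) volume a b := (hf.pow 2).intervalIntegrable
  have hgg : IntervalIntegrable (fun x => g x ^ 2) volume a b := (hg.pow 2).intervalIntegrable
  have hfg : IntervalIntegrable (fun x => f x * g x) volume a b := (hf.mul hg).intervalIntegrable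
  have key (t : ℝ) : 0 ≤ (∫ x in a..b, f x ^ 2) * (t * t) + (2 * ∫ x in a..b, f x * g x) * t +
      ∫ x in a..b, g x ^ 2 := by
    have h : ∫ x in a..b, (t * f x + g x) ^ 2 = (∫ x in a..b, f x ^ 2) * (t * t) +
        (2 * ∫ x in a..b, f x * g x) * t + ∫ x in a..b, g x ^ 2 := by
      rw [mul_comm 2, mul_assoc, ← intervalIntegral.integral_mul_const,
        ← intervalIntegral.integral_mul_const,
        ← intervalIntegral.integral_add (hff.mul_const _) (hfg.mul_const _),
        ← intervalIntegral.integral_add ((hff.mul_const _).add (hfg.mul_const _)) hgg]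
      congr 1 with x
      ring
    rw [← h]
    exact intervalIntegral.integral_nonneg hab fun x _ => sq_nonneg _
  have := discrim_le_zero key
  rw [discrim] at this
  linarith

lemma iteratedDeriv_eval (p : ℝ[X]) (k : ℕ) :
    iteratedDeriv k (fun x => p.eval x) = fun x => (derivative^[k] p).eval x := by
  induction k with
  | zero => simp
  | succ k ih =>
    rw [iteratedDeriv_succ, ih, Function.iterate_succ_apply']
    ext x
    exact Polynomial.deriv _

lemma legendreP_eq_eval (n : ℕ) (x : ℝ) :
    legendreP n x =
      1 / (2 ^ n * n.factorial) * (derivative^[n] ((X ^ 2 - 1 : ℝ[X]) ^ n)).eval x := by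
  have h := congrFun (iteratedDeriv_eval ((X ^ 2 - 1 : ℝ[X]) ^ n) n) x
  simp only [eval_pow, eval_sub, eval_X, eval_one] at h
  rw [legendreP, h]

theorem flCoeff_le_first_deriv (v : ℝ → ℝ)
    (hv : ContDiffOn ℝ 1 v (Set.Icc (-1) 1)) (n : ℕ) (hn : 1 ≤ n) :
    |flCoeff v n| ≤
      Real.sqrt 2 * L2norm (derivWithin v (Set.Icc (-1) 1)) / Real.sqrt (2 * (n : ℝ) - 1) := by
  obtain ⟨m, rfl⟩ := Nat.exists_eq_add_of_le' hn
  set v' := derivWithin v (Set.Icc (-1) 1)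
  have hcont : ContinuousOn v' (Set.Icc (-1) 1) :=
    hv.continuousOn_derivWithin (uniqueDiffOn_Icc (by norm_num)) le_rfl
  have hderiv (x : ℝ) (hx : x ∈ Set.Icc (-1 : ℝ) 1) :
      HasDerivWithinAt v (v' x) (Set.Icc (-1) 1) x :=
    (hv.differentiableOn one_ne_zero x hx).hasDerivWithinAt
  set p : ℝ[X] := derivative^[m] ((X ^ 2 - 1 : ℝ[X]) ^ (m + 1)) with hp
  set c : ℝ := 2 ^ (m + 1) * (m + 1).factorial with hc
  have hc0 : 0 < c := by positivity
  have hcoeff : flCoeff v (m + 1) =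
      -((2 * m + 3) / (2 * c)) * ∫ x in (-1 : ℝ)..1, v' x * p.eval x := by
    have hint : ∫ x in (-1 : ℝ)..1, v x * legendreP (m + 1) x =
        1 / c * ∫ x in (-1 : ℝ)..1, v x * (derivative p).eval x := by
      rw [← intervalIntegral.integral_const_mul]
      congr 1 with x
      rw [legendreP_eq_eval, Function.iterate_succ_apply']
      ring
    rw [flCoeff, hint, integral_mul_eval_derivative
      (X_sq_sub_one_dvd_iterate_derivative m.lt_succ_self) hderiv hcont]
    push_cast
    field_simp
    ring
  have hcs := sq_intervalIntegral_mul_le (by norm_num : (-1 : ℝ) ≤ 1) hcont p.continuousOn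
  rw [hp, integral_sq_eval_iterate_derivative, ← hp, ← hc] at hcs
  have hA : 0 ≤ ∫ x in (-1 : ℝ)..1, v' x ^ 2 :=
    intervalIntegral.integral_nonneg (by norm_num) fun x _ => sq_nonneg _
  have hm : (0 : ℝ) < 2 * ((m + 1 : ℕ) : ℝ) - 1 := by push_cast; linarith [m.cast_nonneg (α := ℝ)]
  rw [L2norm, ← Real.sqrt_mul (by norm_num), ← Real.sqrt_div' _ hm.le]
  refine Real.abs_le_sqrt ?_
  rw [hcoeff, mul_pow]
  refine (mul_le_mul_of_nonneg_left hcs (sq_nonneg _)).trans ?_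
  have h : (-((2 * (m : ℝ) + 3) / (2 * c))) ^ 2 * ((∫ x in (-1 : ℝ)..1, v' x ^ 2) *
      (c ^ 2 * (4 / ((2 * m + 1) * (2 * m + 3) * (2 * m + 5))))) =
      (∫ x in (-1 : ℝ)..1, v' x ^ 2) / (2 * m + 1) * ((2 * m + 3) / (2 * m + 5)) := by
    field_simp
    ring
  have hq : (2 * (m : ℝ) + 3) / (2 * m + 5) ≤ 2 := by
    rw [div_le_iff₀ (by positivity)]
    linarith [m.cast_nonneg (α := ℝ)]
  rw [h, show 2 * ((m + 1 : ℕ) : ℝ) - 1 = 2 * m + 1 by push_cast; ring]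
  refine (mul_le_mul_of_nonneg_left hq (by positivity)).trans_eq ?_
  ring
end

section
/- Let 0 < α < 1 and λ > 0, and define y(t) = E_α(−λ t^α) for t ≥ 0. Then for every t > 0, y is differentiable on (0,t), the function s ↦ y'(s)(t−s)^{−α} is integrable on (0,t), and (1/Γ(1−α)) ∫_0^t y'(s)(t−s)^{−α} ds = −λ E_α(−λ t^α); that is, the Caputo fractional derivative of order α of E_α(−λ t^α) equals −λ E_α(−λ t^α). -/
open MeasureTheory

/-- The real two-parameter Mittag-Leffler function `E_{α,β}(x) = Σ_{k≥0} x^k/Γ(αk+β)`. -/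
noncomputable def mlE (α β x : ℝ) : ℝ :=
  ∑' k : ℕ, x ^ k / Real.Gamma (α * (k : ℝ) + β)

theorem exp_neg_mul_rpow_le_Gamma {R x : ℝ} (hR : 0 < R) (hx : 1 ≤ x) :
    Real.exp (-R) * R ^ (x - 1) ≤ Real.Gamma x := by
  have hint := Real.GammaIntegral_convergent (s := x) (by linarith)
  have hsub : Set.Ioi R ⊆ Set.Ioi (0 : ℝ) := Set.Ioi_subset_Ioi hR.le
  calc
    Real.exp (-R) * R ^ (x - 1) = ∫ u in Set.Ioi R, Real.exp (-u) * R ^ (x - 1) := by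
      rw [integral_mul_const, integral_exp_neg_Ioi]
    _ ≤ ∫ u in Set.Ioi R, Real.exp (-u) * u ^ (x - 1) := by
      refine setIntegral_mono_on ?_ (hint.mono_set hsub) measurableSet_Ioi fun u hu => ?_
      · exact (integrableOn_exp_neg_Ioi R).mul_const _
      · have : R ≤ u := le_of_lt hu
        gcongr
    _ ≤ ∫ u in Set.Ioi 0, Real.exp (-u) * u ^ (x - 1) := by
      refine setIntegral_mono_set hint ?_ hsub.eventuallyLE
      filter_upwards [ae_restrict_mem measurableSet_Ioi] with u hu
      have : 0 < u := hu
      simp only [Pi.zero_apply]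
      positivity
    _ = Real.Gamma x := (Real.Gamma_eq_integral (by linarith)).symm

/-- The Mittag-Leffler series converges everywhere. -/
theorem summable_pow_div_Gamma {α : ℝ} (hα : 0 < α) (β x : ℝ) :
    Summable fun k : ℕ => x ^ k / Real.Gamma (α * (k : ℝ) + β) := by
  set b : ℝ := 2 * (|x| + 1) with hb
  have hb0 : 0 < b := by positivity
  set R : ℝ := b ^ α⁻¹ with hRdef
  have hR : 0 < R := by positivity
  have hRα : R ^ α = b := Real.rpow_inv_rpow hb0.le hα.ne'
  have hgeom : Summable fun k : ℕ => (Real.exp R * R ^ (1 - β)) * (1 / 2 : ℝ) ^ k :=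
    (summable_geometric_of_lt_one (by norm_num) (by norm_num)).mul_left _
  refine hgeom.of_norm_bounded_eventually_nat ?_
  have hlarge : ∀ᶠ k : ℕ in Filter.atTop, 1 ≤ α * (k : ℝ) + β :=
    (Filter.tendsto_atTop_add_const_right _ β
      (tendsto_natCast_atTop_atTop.const_mul_atTop hα)).eventually_ge_atTop 1
  filter_upwards [hlarge] with k hk
  have hG := exp_neg_mul_rpow_le_Gamma hR hk
  have hpow : R ^ (α * (k : ℝ) + β - 1) = b ^ k / R ^ (1 - β) := by
    rw [show α * (k : ℝ) + β - 1 = α * k - (1 - β) by ring, Real.rpow_sub hR, Real.rpow_mul hR.le,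
      hRα, Real.rpow_natCast]
  have hxb : |x| ≤ b * (1 / 2) := by rw [hb]; linarith
  rw [norm_div, norm_pow, Real.norm_eq_abs, Real.norm_of_nonneg (Real.Gamma_nonneg_of_nonneg
    (by linarith)), div_le_iff₀ (Real.Gamma_pos_of_pos (by linarith))]
  calc
    |x| ^ k ≤ (b * (1 / 2)) ^ k := by gcongr
    _ = Real.exp R * R ^ (1 - β) * (1 / 2) ^ k * (Real.exp (-R) * R ^ (α * (k : ℝ) + β - 1)) := by
      rw [hpow, Real.exp_neg, mul_pow]
      have := Real.rpow_pos_of_pos hR (1 - β)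
      field_simp
    _ ≤ _ := by gcongr

theorem hasSum_mlE {α : ℝ} (hα : 0 < α) (β x : ℝ) :
    HasSum (fun k : ℕ => x ^ k / Real.Gamma (α * (k : ℝ) + β)) (mlE α β x) :=
  (summable_pow_div_Gamma hα β x).hasSum

theorem hasDerivAt_mlE_one {α : ℝ} (hα : 0 < α) (x : ℝ) :
    HasDerivAt (mlE α 1) (mlE α α x / α) x := by
  set r : ℝ := |x| + 1 with hr
  have hderiv_zero (y : ℝ) :
      ((0 : ℕ) : ℝ) * y ^ (0 - 1) / Real.Gamma (α * ((0 : ℕ) : ℝ) + 1) = 0 := by simp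
  have hderiv_succ (y : ℝ) (k : ℕ) :
      ((k + 1 : ℕ) : ℝ) * y ^ (k + 1 - 1) / Real.Gamma (α * ((k + 1 : ℕ) : ℝ) + 1) =
        y ^ k / Real.Gamma (α * (k : ℝ) + α) / α := by
    have hpos : 0 < α * ((k + 1 : ℕ) : ℝ) := by positivity
    have hG := Real.Gamma_pos_of_pos hpos
    rw [Real.Gamma_add_one hpos.ne',
      show α * (k : ℝ) + α = α * ((k + 1 : ℕ) : ℝ) by push_cast; ring, Nat.add_sub_cancel]
    field_simp
  have hsum (y : ℝ) : Summable fun k : ℕ =>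
      (k : ℝ) * y ^ (k - 1) / Real.Gamma (α * (k : ℝ) + 1) := by
    rw [← summable_nat_add_iff 1]
    simp_rw [hderiv_succ]
    exact (summable_pow_div_Gamma hα α y).div_const α
  have hmem : x ∈ Metric.ball (0 : ℝ) r := by simp [hr]
  have key := hasDerivAt_tsum_of_isPreconnected (hsum r) Metric.isOpen_ball
    (convex_ball (0 : ℝ) r).isPreconnected
    (g := fun (k : ℕ) (y : ℝ) => y ^ k / Real.Gamma (α * (k : ℝ) + 1))
    (g' := fun (k : ℕ) (y : ℝ) => (k : ℝ) * y ^ (k - 1) / Real.Gamma (α * (k : ℝ) + 1))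
    (fun k y _ => (hasDerivAt_pow k y).div_const _)
    (fun k y hy => by
      have hy' : |y| ≤ r := by simpa using (mem_ball_zero_iff.mp hy).le
      have hG : 0 < Real.Gamma (α * (k : ℝ) + 1) := Real.Gamma_pos_of_pos (by positivity)
      rw [norm_div, norm_mul, norm_pow, Real.norm_of_nonneg hG.le, Real.norm_natCast,
        Real.norm_eq_abs]
      gcongr)
    hmem (summable_pow_div_Gamma hα 1 x) hmem
  have hval : mlE α α x / α = ∑' k : ℕ, (k : ℝ) * x ^ (k - 1) / Real.Gamma (α * (k : ℝ) + 1) := by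
    rw [(hsum x).tsum_eq_zero_add, hderiv_zero, zero_add]
    simp_rw [hderiv_succ]
    rw [tsum_div_const, mlE]
  rw [hval]
  exact key

theorem hasDerivAt_mlE_const_mul_rpow {α s : ℝ} (hα : 0 < α) (c : ℝ) (hs : 0 < s) :
    HasDerivAt (fun τ : ℝ => mlE α 1 (c * τ ^ α)) (c * s ^ (α - 1) * mlE α α (c * s ^ α)) s := by
  have h := (hasDerivAt_mlE_one hα (c * s ^ α)).comp s
    ((Real.hasDerivAt_rpow_const (p := α) (Or.inl hs.ne')).const_mul c)
  refine h.congr_deriv ?_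
  field_simp

/-- The Beta integral on `(0, t)`. -/
theorem setIntegral_rpow_mul_sub_rpow {u v t : ℝ} (hu : 0 < u) (hv : 0 < v) (ht : 0 < t) :
    ∫ s in Set.Ioo 0 t, s ^ (u - 1) * (t - s) ^ (v - 1) =
      t ^ (u + v - 1) * (Real.Gamma u * Real.Gamma v / Real.Gamma (u + v)) := by
  have h := Complex.betaIntegral_scaled (u : ℂ) (v : ℂ) ht
  rw [Complex.betaIntegral_eq_Gamma_mul_div _ _ (by simpa) (by simpa),
    intervalIntegral.integral_of_le ht.le, integral_Ioc_eq_integral_Ioo] at h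
  apply Complex.ofReal_injective
  rw [← integral_complex_ofReal]
  convert h using 1
  · refine setIntegral_congr_fun measurableSet_Ioo fun s hs => ?_
    have h1 : 0 ≤ s := hs.1.le
    have h2 : 0 ≤ t - s := by linarith [hs.2]
    simp only [Complex.ofReal_mul, Complex.ofReal_cpow h1, Complex.ofReal_cpow h2]
    push_cast
    rfl
  · rw [Complex.ofReal_mul, Complex.ofReal_cpow ht.le]
    push_cast [← Complex.Gamma_ofReal]
    rfl

theorem integrableOn_rpow_mul_sub_rpow {u v t : ℝ} (hu : 0 < u) (hv : 0 < v) (ht : 0 < t) :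
    IntegrableOn (fun s : ℝ => s ^ (u - 1) * (t - s) ^ (v - 1)) (Set.Ioo 0 t) := by
  refine Integrable.of_integral_ne_zero ?_
  rw [setIntegral_rpow_mul_sub_rpow hu hv ht]
  have h1 := Real.Gamma_pos_of_pos hu
  have h2 := Real.Gamma_pos_of_pos hv
  have h3 := Real.Gamma_pos_of_pos (add_pos hu hv)
  positivity

/-- The kernel `(t - s)^(-α)` integrates the series of `c s^(α-1) E_{α,α}(c s^α)` termwise. -/
theorem integrableOn_and_integral_mlE {α t : ℝ} (hα0 : 0 < α) (hα1 : α < 1) (c : ℝ) (ht : 0 < t) :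
    IntegrableOn (fun s : ℝ => c * s ^ (α - 1) * mlE α α (c * s ^ α) * (t - s) ^ (-α))
      (Set.Ioo 0 t) ∧
    ∫ s in Set.Ioo 0 t, c * s ^ (α - 1) * mlE α α (c * s ^ α) * (t - s) ^ (-α) =
      Real.Gamma (1 - α) * (c * mlE α 1 (c * t ^ α)) := by
  have hΓ : 0 < Real.Gamma (1 - α) := Real.Gamma_pos_of_pos (by linarith)
  have hu (k : ℕ) : 0 < α * (k : ℝ) + α := by positivity
  let F : ℝ → ℕ → ℝ → ℝ := fun d k s =>
    d ^ (k + 1) / Real.Gamma (α * k + α) * (s ^ (α * k + α - 1) * (t - s) ^ (1 - α - 1))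
  have hFint (d : ℝ) (k : ℕ) : IntegrableOn (F d k) (Set.Ioo 0 t) :=
    (integrableOn_rpow_mul_sub_rpow (hu k) (by linarith) ht).const_mul _
  have hFval (d : ℝ) (k : ℕ) : ∫ s in Set.Ioo 0 t, F d k s =
      Real.Gamma (1 - α) * (d * ((d * t ^ α) ^ k / Real.Gamma (α * k + 1))) := by
    have := Real.Gamma_pos_of_pos (hu k)
    rw [integral_const_mul, setIntegral_rpow_mul_sub_rpow (hu k) (by linarith) ht,
      show α * (k : ℝ) + α + (1 - α) = α * k + 1 by ring, add_sub_cancel_right,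
      Real.rpow_mul ht.le, Real.rpow_natCast, mul_pow, pow_succ]
    field_simp
  have hFvalSum (d : ℝ) : HasSum (fun k => ∫ s in Set.Ioo 0 t, F d k s)
      (Real.Gamma (1 - α) * (d * mlE α 1 (d * t ^ α))) := by
    simp_rw [hFval]
    exact ((hasSum_mlE hα0 1 _).mul_left d).mul_left _
  have hFsum (d : ℝ) {s : ℝ} (hs : s ∈ Set.Ioo 0 t) : HasSum (fun k => F d k s)
      (d * s ^ (α - 1) * mlE α α (d * s ^ α) * (t - s) ^ (-α)) := by
    have h := ((hasSum_mlE hα0 α (d * s ^ α)).mul_left (d * s ^ (α - 1))).mul_right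
      ((t - s) ^ (-α))
    convert! h using 2 with k
    simp only [F]
    rw [show α * (k : ℝ) + α - 1 = α * k + (α - 1) by ring, Real.rpow_add hs.1,
      Real.rpow_mul hs.1.le, Real.rpow_natCast, show 1 - α - 1 = -α by ring]
    ring
  have hFnorm (d : ℝ) (k : ℕ) {s : ℝ} (hs : s ∈ Set.Ioo 0 t) : ‖F d k s‖ = F |d| k s := by
    have h1 : 0 ≤ s := hs.1.le
    have h2 : 0 ≤ t - s := by linarith [hs.2]
    have h3 := Real.Gamma_pos_of_pos (hu k)
    simp only [F]
    rw [norm_mul, norm_div, norm_pow, Real.norm_eq_abs, Real.norm_of_nonneg h3.le,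
      Real.norm_of_nonneg (by positivity)]
  have hFnormSum (d : ℝ) : Summable fun k => ∫ s in Set.Ioo 0 t, ‖F d k s‖ := by
    refine (hFvalSum |d|).summable.congr fun k => ?_
    exact (setIntegral_congr_fun measurableSet_Ioo fun s hs => hFnorm d k hs).symm
  have hval (d : ℝ) :
      ∫ s in Set.Ioo 0 t, d * s ^ (α - 1) * mlE α α (d * s ^ α) * (t - s) ^ (-α) =
        Real.Gamma (1 - α) * (d * mlE α 1 (d * t ^ α)) := by
    rw [← (hFvalSum d).tsum_eq, integral_tsum_of_summable_integral_norm (hFint d) (hFnormSum d)]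
    exact setIntegral_congr_fun measurableSet_Ioo fun s hs => (hFsum d hs).tsum_eq.symm
  refine ⟨?_, hval c⟩
  rcases eq_or_ne c 0 with rfl | hc
  · simp
  -- The majorant obtained by replacing `c` with `|c|` has a positive, hence convergent, integral.
  have hmajorant : IntegrableOn
      (fun s : ℝ => |c| * s ^ (α - 1) * mlE α α (|c| * s ^ α) * (t - s) ^ (-α))
      (Set.Ioo 0 t) := by
    refine Integrable.of_integral_ne_zero ?_
    rw [hval]
    have hpos : 0 < mlE α 1 (|c| * t ^ α) := by
      refine (summable_pow_div_Gamma hα0 1 _).tsum_pos (fun k => ?_) 0 (by simp)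
      have : 0 < Real.Gamma (α * (k : ℝ) + 1) := Real.Gamma_pos_of_pos (by positivity)
      positivity
    have := abs_pos.mpr hc
    positivity
  have hmeas : AEStronglyMeasurable
      (fun s : ℝ => c * s ^ (α - 1) * mlE α α (c * s ^ α) * (t - s) ^ (-α))
      (volume.restrict (Set.Ioo 0 t)) := by
    have hderiv : Measurable fun s : ℝ =>
        deriv (fun τ : ℝ => mlE α 1 (c * τ ^ α)) s * (t - s) ^ (-α) :=
      (measurable_deriv _).mul (by fun_prop)
    refine hderiv.aestronglyMeasurable.congr ?_
    filter_upwards [ae_restrict_mem measurableSet_Ioo] with s hs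
    rw [(hasDerivAt_mlE_const_mul_rpow hα0 c hs.1).deriv]
  refine hmajorant.mono' hmeas ?_
  filter_upwards [ae_restrict_mem measurableSet_Ioo] with s hs
  rw [← (hFsum c hs).tsum_eq]
  exact tsum_of_norm_bounded (hFsum |c| hs) fun k => (hFnorm c k hs).le

theorem caputo_mittagLeffler (α lam : ℝ) (hα0 : 0 < α) (hα1 : α < 1) (hlam : 0 < lam)
    (t : ℝ) (ht : 0 < t) :
    DifferentiableOn ℝ (fun s : ℝ => mlE α 1 (-lam * s ^ α)) (Set.Ioo 0 t) ∧
    IntegrableOn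
      (fun s : ℝ => deriv (fun τ : ℝ => mlE α 1 (-lam * τ ^ α)) s * (t - s) ^ (-α))
      (Set.Ioo 0 t) ∧
    (1 / Real.Gamma (1 - α)) *
        ∫ s in Set.Ioo 0 t, deriv (fun τ : ℝ => mlE α 1 (-lam * τ ^ α)) s * (t - s) ^ (-α)
      = -lam * mlE α 1 (-lam * t ^ α) := by
  have hderiv {s : ℝ} (hs : s ∈ Set.Ioo 0 t) :=
    hasDerivAt_mlE_const_mul_rpow hα0 (-lam) hs.1
  have hcongr : Set.EqOn
      (fun s : ℝ => deriv (fun τ : ℝ => mlE α 1 (-lam * τ ^ α)) s * (t - s) ^ (-α))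
      (fun s : ℝ => -lam * s ^ (α - 1) * mlE α α (-lam * s ^ α) * (t - s) ^ (-α))
      (Set.Ioo 0 t) := fun s hs => by simp only [(hderiv hs).deriv]
  obtain ⟨hint, hval⟩ := integrableOn_and_integral_mlE hα0 hα1 (-lam) ht
  refine ⟨fun s hs => (hderiv hs).differentiableAt.differentiableWithinAt,
    hint.congr_fun hcongr.symm measurableSet_Ioo, ?_⟩
  have hΓ : 0 < Real.Gamma (1 - α) := Real.Gamma_pos_of_pos (by linarith)
  rw [setIntegral_congr_fun measurableSet_Ioo hcongr, hval, ← mul_assoc, one_div_mul_cancel hΓ.ne',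
    one_mul]
end

section
/- Let 0 < α < 1, T > 0, λ > 0 and h ∈ ℝ. Suppose y : [0,T] → ℝ is continuous on [0,T], continuously differentiable on (0,T], for each t ∈ (0,T] the function s ↦ y'(s)(t−s)^{−α} is integrable on (0,t), and y satisfies (1/Γ(1−α)) ∫_0^t y'(s)(t−s)^{−α} ds + λ y(t) = h for all t ∈ (0,T], together with y(0) = 0 and y(T) = 0. Then h = 0 and y(t) = 0 for all t ∈ [0,T]. -/
open MeasureTheory

/-- If `g` is differentiable from within `Icc 0 t` at `t` and vanishes there, then
`g s * (t - s) ^ (-α)` tends to zero as `s` tends to `t`, for `α < 1`. -/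
lemma continuousWithinAt_mul_sub_rpow_neg {α t d : ℝ} (hα1 : α < 1)
    {g : ℝ → ℝ} (hg : HasDerivWithinAt g d (Set.Icc 0 t) t) (hgt : g t = 0) :
    ContinuousWithinAt (fun s => g s * (t - s) ^ (-α)) (Set.Icc 0 t) t := by
  have hO : g =O[nhdsWithin t (Set.Icc 0 t)] fun s => s - t := by
    simpa [hgt] using hg.hasFDerivWithinAt.isBigO_sub
  obtain ⟨C, hC⟩ := hO.bound
  have hlim : Filter.Tendsto (fun s : ℝ => C * (t - s) ^ (1 - α))
      (nhdsWithin t (Set.Icc 0 t)) (nhds 0) := by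
    have hcont : Continuous fun s : ℝ => C * (t - s) ^ (1 - α) :=
      continuous_const.mul ((continuous_const.sub continuous_id).rpow_const
        fun _ => Or.inr (by linarith))
    have := (hcont.tendsto t).mono_left (nhdsWithin_le_nhds (s := Set.Icc 0 t))
    simpa [Real.zero_rpow (by linarith : (1 : ℝ) - α ≠ 0)] using this
  have hval : g t * (t - t) ^ (-α) = 0 := by simp [hgt]
  simp only [ContinuousWithinAt, hval]
  refine squeeze_zero_norm' ?_ hlim
  filter_upwards [hC, self_mem_nhdsWithin] with s hs hst
  rcases hst.2.eq_or_lt with rfl | hlt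
  · simp [hgt, Real.zero_rpow (by linarith : (1 : ℝ) - α ≠ 0)]
  · have hpos : 0 < t - s := sub_pos.2 hlt
    have hnorm : ‖s - t‖ = t - s := by rw [norm_sub_rev, Real.norm_of_nonneg hpos.le]
    rw [norm_mul, Real.norm_of_nonneg (Real.rpow_nonneg hpos.le _), sub_eq_add_neg 1 α,
      Real.rpow_add hpos, Real.rpow_one, ← mul_assoc]
    rw [hnorm] at hs
    exact mul_le_mul_of_nonneg_right hs (Real.rpow_nonneg hpos.le _)

/-- Extremum principle: up to a positive factor, the Caputo derivative of a function on `[0, t]`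
is nonpositive at `t` if the function attains its minimum there. -/
lemma setIntegral_mul_sub_rpow_neg_nonpos_of_isMinOn {α t : ℝ} (hα0 : 0 < α) (hα1 : α < 1)
    (ht : 0 < t) {y y' : ℝ → ℝ} (hycont : ContinuousOn y (Set.Icc 0 t))
    (hyderiv : ∀ s ∈ Set.Ioc (0 : ℝ) t, HasDerivWithinAt y (y' s) (Set.Icc 0 t) s)
    (hint : IntegrableOn (fun s : ℝ => y' s * (t - s) ^ (-α)) (Set.Ioo 0 t))
    (hmin : IsMinOn y (Set.Icc 0 t) t) :
    ∫ s in Set.Ioo 0 t, y' s * (t - s) ^ (-α) ≤ 0 := by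
  have hnonneg : ∀ s ∈ Set.Icc 0 t, 0 ≤ y s - y t := fun s hs => sub_nonneg.2 (hmin hs)
  have hcont : ContinuousOn (fun s => (y s - y t) * (t - s) ^ (-α)) (Set.Icc 0 t) := by
    intro s hs
    rcases hs.2.eq_or_lt with rfl | hlt
    · exact continuousWithinAt_mul_sub_rpow_neg hα1
        ((hyderiv s ⟨ht, le_rfl⟩).sub_const (y s)) (sub_self _)
    · exact ((hycont s hs).sub continuousWithinAt_const).mul
        ((continuousWithinAt_const.sub continuousWithinAt_id).rpow_const
          (Or.inl (sub_pos.2 hlt).ne'))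
  have hderiv : ∀ s ∈ Set.Ioo 0 t, HasDerivWithinAt (fun s => (y s - y t) * (t - s) ^ (-α))
      (y' s * (t - s) ^ (-α) + (y s - y t) * (α * (t - s) ^ (-α - 1))) (Set.Ioi s) s := by
    intro s hs
    have hy : HasDerivAt y (y' s) s :=
      (hyderiv s ⟨hs.1, hs.2.le⟩).hasDerivAt (Icc_mem_nhds hs.1 hs.2)
    have hpow : HasDerivAt (fun s => (t - s) ^ (-α)) (α * (t - s) ^ (-α - 1)) s := by
      simpa using ((hasDerivAt_id' s).const_sub t).rpow_const (p := -α)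
        (Or.inl (sub_pos.2 hs.2).ne')
    exact ((hy.sub_const (y t)).fun_mul hpow).hasDerivWithinAt
  have hle := intervalIntegral.integral_le_sub_of_hasDeriv_right_of_le ht.le hcont hderiv
    ((integrableOn_Icc_iff_integrableOn_Ioo enorm_ne_top enorm_ne_top).2 hint) fun s hs =>
      le_add_of_nonneg_right (mul_nonneg (hnonneg s ⟨hs.1.le, hs.2.le⟩)
        (mul_nonneg hα0.le (Real.rpow_nonneg (sub_pos.2 hs.2).le _)))
  rw [intervalIntegral.integral_of_le ht.le, integral_Ioc_eq_integral_Ioo] at hle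
  have h0 : 0 ≤ (y 0 - y t) * (t - 0) ^ (-α) :=
    mul_nonneg (hnonneg 0 ⟨le_rfl, ht.le⟩) (Real.rpow_nonneg (by linarith) _)
  simp only [sub_self, zero_mul] at hle
  linarith

/-- If a solution of the Caputo equation attains its minimum over `[0, T]` at `t > 0`, then the
right-hand side is at most `lam * y t`. -/
lemma caputo_rhs_le_of_isMinOn {α T lam h : ℝ} (hα0 : 0 < α) (hα1 : α < 1) {y y' : ℝ → ℝ}
    (hycont : ContinuousOn y (Set.Icc 0 T))
    (hyderiv : ∀ t ∈ Set.Ioc (0 : ℝ) T, HasDerivWithinAt y (y' t) (Set.Icc 0 T) t)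
    (hint : ∀ t ∈ Set.Ioc (0 : ℝ) T,
      IntegrableOn (fun s : ℝ => y' s * (t - s) ^ (-α)) (Set.Ioo 0 t))
    (heq : ∀ t ∈ Set.Ioc (0 : ℝ) T,
      (1 / Real.Gamma (1 - α)) * (∫ s in Set.Ioo 0 t, y' s * (t - s) ^ (-α)) + lam * y t = h)
    {t : ℝ} (ht : t ∈ Set.Ioc 0 T) (hmin : IsMinOn y (Set.Icc 0 T) t) :
    h ≤ lam * y t := by
  have hsub : Set.Icc 0 t ⊆ Set.Icc 0 T := Set.Icc_subset_Icc_right ht.2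
  have hI := setIntegral_mul_sub_rpow_neg_nonpos_of_isMinOn hα0 hα1 ht.1 (hycont.mono hsub)
    (fun s hs => (hyderiv s ⟨hs.1, hs.2.trans ht.2⟩).mono hsub) (hint t ht)
    (hmin.on_subset hsub)
  have hΓ : 0 ≤ 1 / Real.Gamma (1 - α) :=
    (one_div_pos.2 (Real.Gamma_pos_of_pos (by linarith))).le
  linarith [heq t ht, mul_nonpos_of_nonneg_of_nonpos hΓ hI]

/-- A solution of the Caputo equation vanishing at both endpoints has nonpositive right-hand side,
and is nonnegative if the right-hand side is. -/
lemma caputo_rhs_nonpos_and_nonneg {α T lam h : ℝ}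
    (hα0 : 0 < α) (hα1 : α < 1) (hT : 0 < T) (hlam : 0 < lam) {y y' : ℝ → ℝ}
    (hycont : ContinuousOn y (Set.Icc 0 T))
    (hyderiv : ∀ t ∈ Set.Ioc (0 : ℝ) T, HasDerivWithinAt y (y' t) (Set.Icc 0 T) t)
    (hint : ∀ t ∈ Set.Ioc (0 : ℝ) T,
      IntegrableOn (fun s : ℝ => y' s * (t - s) ^ (-α)) (Set.Ioo 0 t))
    (heq : ∀ t ∈ Set.Ioc (0 : ℝ) T,
      (1 / Real.Gamma (1 - α)) * (∫ s in Set.Ioo 0 t, y' s * (t - s) ^ (-α)) + lam * y t = h)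
    (hy0 : y 0 = 0) (hyT : y T = 0) :
    h ≤ 0 ∧ (0 ≤ h → ∀ t ∈ Set.Icc (0 : ℝ) T, 0 ≤ y t) := by
  obtain ⟨t, ht, hmin⟩ : ∃ t ∈ Set.Ioc 0 T, IsMinOn y (Set.Icc 0 T) t := by
    obtain ⟨t, ht, hmin⟩ := isCompact_Icc.exists_isMinOn (Set.nonempty_Icc.2 hT.le) hycont
    rcases ht.1.eq_or_lt with rfl | hpos
    · exact ⟨T, ⟨hT, le_rfl⟩, fun s hs => by simpa [hy0, hyT] using hmin hs⟩
    · exact ⟨t, ⟨hpos, ht.2⟩, hmin⟩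
  have hle := caputo_rhs_le_of_isMinOn hα0 hα1 hycont hyderiv hint heq ht hmin
  have hyt : y t ≤ 0 := hyT ▸ hmin (Set.right_mem_Icc.2 hT.le)
  exact ⟨hle.trans (mul_nonpos_of_nonneg_of_nonpos hlam.le hyt), fun hh s hs =>
    (nonneg_of_mul_nonneg_right (hh.trans hle) hlam).trans (hmin hs)⟩

theorem caputo_uniqueness_ode (α T lam h : ℝ)
    (hα0 : 0 < α) (hα1 : α < 1) (hT : 0 < T) (hlam : 0 < lam)
    (y y' : ℝ → ℝ)
    (hycont : ContinuousOn y (Set.Icc 0 T))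
    (hyderiv : ∀ t ∈ Set.Ioc (0 : ℝ) T, HasDerivWithinAt y (y' t) (Set.Icc 0 T) t)
    (hy'cont : ContinuousOn y' (Set.Ioc 0 T))
    (hint : ∀ t ∈ Set.Ioc (0 : ℝ) T,
      IntegrableOn (fun s : ℝ => y' s * (t - s) ^ (-α)) (Set.Ioo 0 t))
    (heq : ∀ t ∈ Set.Ioc (0 : ℝ) T,
      (1 / Real.Gamma (1 - α)) * (∫ s in Set.Ioo 0 t, y' s * (t - s) ^ (-α)) + lam * y t = h)
    (hy0 : y 0 = 0) (hyT : y T = 0) :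
    h = 0 ∧ ∀ t ∈ Set.Icc (0 : ℝ) T, y t = 0 := by
  obtain ⟨hle, hnonneg⟩ :=
    caputo_rhs_nonpos_and_nonneg hα0 hα1 hT hlam hycont hyderiv hint heq hy0 hyT
  obtain ⟨hge, hnonpos⟩ := caputo_rhs_nonpos_and_nonneg (y := -y) (y' := -y') (h := -h)
    hα0 hα1 hT hlam hycont.neg (fun t ht => (hyderiv t ht).neg)
    (fun t ht => by simpa using (hint t ht).neg)
    (fun t ht => by
      simp only [Pi.neg_apply, neg_mul, integral_neg, mul_neg]
      linarith [heq t ht])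
    (by simp [hy0]) (by simp [hyT])
  have hh : h = 0 := le_antisymm hle (by linarith)
  exact ⟨hh, fun t ht => le_antisymm (by simpa using hnonpos (by linarith) t ht)
    (hnonneg hh.ge t ht)⟩
end

section
/- Let 0 < α < 1 and T > 0. Suppose U : [0,T] × [−1,1] → ℝ and h : [−1,1] → ℝ are continuous, that for each x ∈ [−1,1] the map t ↦ U(t,x) is continuously differentiable on (0,T] with ∂_tU jointly continuous on (0,T] × [−1,1], that U is twice continuously differentiable in x on [0,T] × [−1,1], and that for each (t,x) ∈ (0,T] × (−1,1) the function s ↦ ∂_sU(s,x)(t−s)^{−α} is integrable on (0,t) and (1/Γ(1−α)) ∫_0^t ∂_sU(s,x)(t−s)^{−α} ds = ∂_x[(1 − x²) ∂_xU(t,x)] + h(x). If U(0,x) = 0 and U(T,x) = 0 for all x ∈ [−1,1], then U ≡ 0 on [0,T] × [−1,1] and h ≡ 0 on [−1,1]. -/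
open MeasureTheory

/-- The kernel `(t - s) ^ (-α)` is integrable on `(0, t)`. -/
lemma integrableOn_sub_rpow_neg {α t : ℝ} (hα1 : α < 1) (ht : 0 < t) :
    IntegrableOn (fun s : ℝ => (t - s) ^ (-α)) (Set.Ioo 0 t) := by
  have h1 : IntervalIntegrable (fun s : ℝ => s ^ (-α)) volume t 0 :=
    intervalIntegral.intervalIntegrable_rpow' (by linarith)
  have h2 := h1.comp_sub_left t
  simp only [sub_self, sub_zero] at h2
  exact ((intervalIntegrable_iff_integrableOn_Ioo_of_le ht.le).1 h2)

/-- If `|a| ≤ C d` then `|a d ^ (-α - 1)| ≤ C d ^ (-α)`. -/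
lemma abs_mul_rpow_neg_sub_one_le {α C a d : ℝ} (hd : 0 < d) (ha : |a| ≤ C * d) :
    |a * d ^ (-α - 1)| ≤ C * d ^ (-α) := by
  rw [abs_mul, abs_of_pos (Real.rpow_pos_of_pos hd _)]
  calc |a| * d ^ (-α - 1) ≤ C * d * d ^ (-α - 1) := by gcongr
    _ = C * d ^ (-α) := by
      rw [Real.rpow_sub_one hd.ne']
      field_simp

/-- A continuous function on `[a, b]` all of whose moments vanish is zero. -/
lemma eq_zero_of_forall_moment_eq_zero {a b : ℝ} (hab : a < b) {f : ℝ → ℝ}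
    (hf : ContinuousOn f (Set.Icc a b)) (hm : ∀ k : ℕ, ∫ x in Set.Icc a b, x ^ k * f x = 0) :
    ∀ x ∈ Set.Icc a b, f x = 0 := by
  have hp : ∀ p : Polynomial ℝ, ∫ x in Set.Icc a b, p.eval x * f x = 0 := by
    intro p
    simp_rw [Polynomial.eval_eq_sum_range, Finset.sum_mul, mul_assoc]
    rw [integral_finsetSum]
    · simp_rw [integral_const_mul, hm]
      simp
    · intro i _
      have hi : IntegrableOn (fun x => x ^ i * f x) (Set.Icc a b) :=
        ContinuousOn.integrableOn_Icc (by fun_prop)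
      exact hi.const_mul _
  have hff : IntegrableOn (fun x => f x * f x) (Set.Icc a b) :=
    (hf.mul hf).integrableOn_Icc
  set A := ∫ x in Set.Icc a b, |f x| with hA
  have hA0 : 0 ≤ A := integral_nonneg fun _ => abs_nonneg _
  have hle : ∀ ε > 0, ∫ x in Set.Icc a b, f x * f x ≤ ε * A := by
    intro ε hε
    obtain ⟨p, hpf⟩ := exists_polynomial_near_of_continuousOn a b f hf ε hε
    have hpi : IntegrableOn (fun x => p.eval x * f x) (Set.Icc a b) :=
      (p.continuous.continuousOn.mul hf).integrableOn_Icc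
    have h1 : ∫ x in Set.Icc a b, f x * f x
        = ∫ x in Set.Icc a b, (f x * f x - p.eval x * f x) := by
      rw [integral_sub hff hpi, hp p, sub_zero]
    rw [h1, hA, ← integral_const_mul]
    refine setIntegral_mono_on (hff.sub hpi) (hf.abs.integrableOn_Icc.const_mul ε)
      measurableSet_Icc fun x hx => ?_
    rw [← sub_mul]
    refine (le_abs_self _).trans ?_
    rw [abs_mul, abs_sub_comm]
    exact mul_le_mul_of_nonneg_right (hpf x hx).le (abs_nonneg _)
  have hzero : ∫ x in Set.Icc a b, f x * f x = 0 := by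
    refine le_antisymm (le_of_forall_pos_le_add fun ε hε => ?_)
      (integral_nonneg fun x => mul_self_nonneg _)
    refine (hle (ε / (A + 1)) (by positivity)).trans ?_
    rw [zero_add, div_mul_eq_mul_div, div_le_iff₀ (by positivity)]
    nlinarith
  have hae := (setIntegral_eq_zero_iff_of_nonneg_ae
    (Filter.Eventually.of_forall fun x => mul_self_nonneg (f x)) hff).1 hzero
  intro x hx
  have := Measure.eqOn_Icc_of_ae_eq volume hab.ne hae (hf.mul hf) continuousOn_const hx
  simpa using this

/-- The Caputo integral of `f` in Marchaud form, for `f` Lipschitz at the endpoint `t`. -/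
lemma integral_deriv_mul_rpow_eq_marchaud {α t C : ℝ} (hα1 : α < 1) (ht : 0 < t)
    {f f' : ℝ → ℝ} (hf : ContinuousOn f (Set.Icc 0 t))
    (hf' : ∀ s ∈ Set.Ioo 0 t, HasDerivAt f (f' s) s)
    (hC : ∀ s ∈ Set.Icc 0 t, |f t - f s| ≤ C * (t - s))
    (hint : IntegrableOn (fun s : ℝ => f' s * (t - s) ^ (-α)) (Set.Ioo 0 t)) :
    ∫ s in Set.Ioo 0 t, f' s * (t - s) ^ (-α)
      = (f t - f 0) * t ^ (-α) + α * ∫ s in Set.Ioo 0 t, (f t - f s) * (t - s) ^ (-α - 1) := by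
  have hkc : ContinuousOn (fun s : ℝ => (t - s) ^ (-α)) (Set.Ico 0 t) := by
    refine ContinuousOn.rpow_const (by fun_prop) fun s hs => Or.inl (sub_pos.2 hs.2).ne'
  have hkc1 : ContinuousOn (fun s : ℝ => (t - s) ^ (-α - 1)) (Set.Ioo 0 t) := by
    refine ContinuousOn.rpow_const (by fun_prop) fun s hs => Or.inl (sub_pos.2 hs.2).ne'
  have hint2 : IntegrableOn (fun s : ℝ => (f t - f s) * (t - s) ^ (-α - 1)) (Set.Ioo 0 t) := by
    refine Integrable.mono' ((integrableOn_sub_rpow_neg hα1 ht).const_mul C) ?_ ?_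
    · exact ((continuousOn_const.sub (hf.mono Set.Ioo_subset_Icc_self)).mul
        hkc1).aestronglyMeasurable measurableSet_Ioo
    · filter_upwards [ae_restrict_mem measurableSet_Ioo] with s hs
      exact abs_mul_rpow_neg_sub_one_le (sub_pos.2 hs.2) (hC s (Set.Ioo_subset_Icc_self hs))
  set F : ℝ → ℝ := fun s => (f s - f t) * (t - s) ^ (-α) with hF
  have hFbound : ∀ s ∈ Set.Icc 0 t, |F s| ≤ C * (t - s) ^ (1 - α) := by
    intro s hs
    rcases hs.2.eq_or_lt with rfl | hst
    · simp [hF, Real.zero_rpow (by linarith : 1 - α ≠ 0)]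
    · have hd := sub_pos.2 hst
      have h1 := abs_mul_rpow_neg_sub_one_le (α := α - 1) hd (hC s hs)
      simp only [neg_sub] at h1
      rw [show (1 - α - 1 : ℝ) = -α by ring] at h1
      simpa only [hF, abs_mul, abs_sub_comm (f s)] using h1
  have hFcont : ContinuousOn F (Set.Icc 0 t) := by
    intro s hs
    rcases hs.2.eq_or_lt with rfl | hst
    · have hF0 : F s = 0 := by simp [hF]
      rw [ContinuousWithinAt, hF0]
      refine squeeze_zero_norm' (a := fun r => C * (s - r) ^ (1 - α)) ?_ ?_
      · filter_upwards [self_mem_nhdsWithin] with r hr using hFbound r hr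
      · have hc : Continuous fun r : ℝ => C * (s - r) ^ (1 - α) :=
          continuous_const.mul
            ((continuous_const.sub continuous_id).rpow_const fun _ => Or.inr (by linarith))
        have := hc.tendsto s
        simp only [sub_self, Real.zero_rpow (by linarith : 1 - α ≠ 0), mul_zero] at this
        exact this.mono_left nhdsWithin_le_nhds
    · refine ((hf s hs).sub continuousWithinAt_const).mul ?_
      exact ((continuousAt_const.sub continuousAt_id).rpow_const
        (Or.inl (sub_pos.2 hst).ne')).continuousWithinAt
  have hFderiv : ∀ s ∈ Set.Ioo 0 t, HasDerivAt F
      (f' s * (t - s) ^ (-α) - α * ((f t - f s) * (t - s) ^ (-α - 1))) s := by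
    intro s hs
    have h1 : HasDerivAt (fun s : ℝ => (t - s) ^ (-α)) (-1 * (-α) * (t - s) ^ (-α - 1)) s :=
      ((hasDerivAt_id s).const_sub t).rpow_const (Or.inl (sub_pos.2 hs.2).ne')
    refine (((hf' s hs).sub_const (f t)).mul h1).congr_deriv ?_
    ring
  have hFint := hint.sub (hint2.const_mul α)
  have key := intervalIntegral.integral_eq_sub_of_hasDerivAt_of_le ht.le hFcont hFderiv
    ((intervalIntegrable_iff_integrableOn_Ioo_of_le ht.le).2 hFint)
  rw [intervalIntegral.integral_of_le ht.le, integral_Ioc_eq_integral_Ioo,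
    integral_sub hint (hint2.const_mul α), integral_const_mul] at key
  simp only [hF, sub_self, zero_mul, sub_zero] at key
  linarith

/-- Minimum principle for the Marchaud form of the fractional relaxation equation. -/
lemma nonneg_of_marchaud_relaxation {α T lam c : ℝ} (hα0 : 0 < α) (hT : 0 < T)
    (hlam : 0 ≤ lam) (hc : 0 ≤ c) {u : ℝ → ℝ} (hu : ContinuousOn u (Set.Icc 0 T))
    (hu0 : u 0 = 0) (huT : u T = 0)
    (heq : ∀ t ∈ Set.Ioc 0 T,
      u t * t ^ (-α) + α * ∫ s in Set.Ioo 0 t, (u t - u s) * (t - s) ^ (-α - 1)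
        = -lam * u t + c) :
    (∀ t ∈ Set.Icc 0 T, 0 ≤ u t) ∧ c = 0 := by
  have hmin : ∀ t ∈ Set.Ioc 0 T, (∀ s ∈ Set.Icc 0 T, u t ≤ u s) →
      -lam * u t + c ≤ u t * t ^ (-α) := by
    intro t ht hle
    have : ∫ s in Set.Ioo 0 t, (u t - u s) * (t - s) ^ (-α - 1) ≤ 0 := by
      refine setIntegral_nonpos measurableSet_Ioo fun s hs => ?_
      exact mul_nonpos_of_nonpos_of_nonneg
        (sub_nonpos.2 (hle s ⟨hs.1.le, hs.2.le.trans ht.2⟩))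
        (Real.rpow_nonneg (sub_pos.2 hs.2).le _)
    rw [← heq t ht]
    nlinarith
  have h0 : (0 : ℝ) ∈ Set.Icc 0 T := ⟨le_rfl, hT.le⟩
  have hnonneg : ∀ t ∈ Set.Icc 0 T, 0 ≤ u t := by
    obtain ⟨r, hr, hrmin⟩ := isCompact_Icc.exists_isMinOn ⟨0, h0⟩ hu
    have hrmin' : ∀ s ∈ Set.Icc 0 T, u r ≤ u s := fun s hs => hrmin hs
    suffices 0 ≤ u r from fun t ht => this.trans (hrmin' t ht)
    rcases hr.1.eq_or_lt with rfl | hr0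
    · exact hu0.ge
    · have h1 := hmin r ⟨hr0, hr.2⟩ hrmin'
      have h2 := Real.rpow_pos_of_pos hr0 (-α)
      by_contra! hneg
      nlinarith [mul_nonneg hlam (neg_nonneg.2 hneg.le), mul_pos (neg_pos.2 hneg) h2]
  refine ⟨hnonneg, le_antisymm ?_ hc⟩
  simpa [huT] using hmin T ⟨hT, le_rfl⟩ (fun s hs => huT.trans_le (hnonneg s hs))

/-- The fractional relaxation equation with a constant source and vanishing data at `0` and `T`
has only the trivial solution, and the source vanishes. -/
lemma eq_zero_of_marchaud_relaxation {α T lam c : ℝ} (hα0 : 0 < α) (hT : 0 < T)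
    (hlam : 0 ≤ lam) {u : ℝ → ℝ} (hu : ContinuousOn u (Set.Icc 0 T))
    (hu0 : u 0 = 0) (huT : u T = 0)
    (heq : ∀ t ∈ Set.Ioc 0 T,
      u t * t ^ (-α) + α * ∫ s in Set.Ioo 0 t, (u t - u s) * (t - s) ^ (-α - 1)
        = -lam * u t + c) :
    (∀ t ∈ Set.Icc 0 T, u t = 0) ∧ c = 0 := by
  have heq' : ∀ t ∈ Set.Ioc 0 T,
      (-u) t * t ^ (-α) + α * ∫ s in Set.Ioo 0 t, ((-u) t - (-u) s) * (t - s) ^ (-α - 1)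
        = -lam * (-u) t + -c := by
    intro t ht
    have h1 : ∀ s, ((-u) t - (-u) s) * (t - s) ^ (-α - 1)
        = -((u t - u s) * (t - s) ^ (-α - 1)) := fun s => by simp only [Pi.neg_apply]; ring
    simp_rw [h1, integral_neg, Pi.neg_apply]
    linarith [heq t ht]
  have hneg := fun hc => nonneg_of_marchaud_relaxation hα0 hT hlam (c := -c) hc hu.neg
    (by simp [hu0]) (by simp [huT]) heq'
  have hpos := fun hc => nonneg_of_marchaud_relaxation hα0 hT hlam (c := c) hc hu hu0 huT heq
  have hc : c = 0 := by
    rcases le_total 0 c with h | h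
    · exact (hpos h).2
    · exact neg_eq_zero.1 (hneg (neg_nonneg.2 h)).2
  refine ⟨fun t ht => le_antisymm ?_ ((hpos hc.ge).1 t ht), hc⟩
  simpa using (hneg (by simp [hc])).1 t ht

/-- Self-adjointness of the Legendre operator tested against a monomial. -/
lemma integral_pow_mul_legendre {v v' v'' : ℝ → ℝ}
    (hv : ∀ x ∈ Set.Icc (-1 : ℝ) 1, HasDerivWithinAt v (v' x) (Set.Icc (-1) 1) x)
    (hv' : ∀ x ∈ Set.Icc (-1 : ℝ) 1, HasDerivWithinAt v' (v'' x) (Set.Icc (-1) 1) x)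
    (hv'' : ContinuousOn v'' (Set.Icc (-1) 1)) (k : ℕ) :
    ∫ x in Set.Icc (-1 : ℝ) 1, x ^ k * ((1 - x ^ 2) * v'' x - 2 * x * v' x)
      = -(k * (k + 1)) * (∫ x in Set.Icc (-1 : ℝ) 1, x ^ k * v x)
        + k * (k - 1) * ∫ x in Set.Icc (-1 : ℝ) 1, x ^ (k - 2) * v x := by
  have hvc : ContinuousOn v (Set.Icc (-1) 1) := fun x hx => (hv x hx).continuousWithinAt
  have hvc' : ContinuousOn v' (Set.Icc (-1) 1) := fun x hx => (hv' x hx).continuousWithinAt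
  set G : ℝ → ℝ := fun x => x ^ k * ((1 - x ^ 2) * v' x) - k * x ^ (k - 1) * (1 - x ^ 2) * v x
    with hG
  have hGc : ContinuousOn G (Set.Icc (-1) 1) := by fun_prop
  have hA : IntegrableOn (fun x => x ^ k * ((1 - x ^ 2) * v'' x - 2 * x * v' x))
      (Set.Icc (-1) 1) := ContinuousOn.integrableOn_Icc (by fun_prop)
  have hB : ∀ j : ℕ, IntegrableOn (fun x => x ^ j * v x) (Set.Icc (-1) 1) := fun j =>
    ContinuousOn.integrableOn_Icc (by fun_prop)
  have hGd : ∀ x ∈ Set.Ioo (-1 : ℝ) 1, HasDerivAt G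
      (x ^ k * ((1 - x ^ 2) * v'' x - 2 * x * v' x)
        + (k * (k + 1) * (x ^ k * v x) - k * (k - 1) * (x ^ (k - 2) * v x))) x := by
    intro x hx
    have hnhds := Icc_mem_nhds hx.1 hx.2
    have h1 := (hv x (Set.Ioo_subset_Icc_self hx)).hasDerivAt hnhds
    have h2 := (hv' x (Set.Ioo_subset_Icc_self hx)).hasDerivAt hnhds
    have h3 : HasDerivAt (fun x : ℝ => 1 - x ^ 2) (-(2 * x)) x := by
      simpa using (hasDerivAt_pow 2 x).const_sub 1
    have h4 := ((hasDerivAt_pow k x).mul (h3.mul h2)).sub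
      ((((hasDerivAt_pow (k - 1) x).const_mul (k : ℝ)).mul h3).mul h1)
    refine h4.congr_deriv ?_
    rcases k with _ | _ | k
    · simp; ring
    · simp; ring
    · simp only [Nat.add_sub_cancel, Nat.reduceSubDiff, Pi.mul_apply]
      push_cast
      ring
  have hB1 := (hB k).const_mul ((k : ℝ) * (k + 1))
  have hB2 := (hB (k - 2)).const_mul ((k : ℝ) * (k - 1))
  have hB12 : IntegrableOn (fun x => (k : ℝ) * (k + 1) * (x ^ k * v x)
      - k * (k - 1) * (x ^ (k - 2) * v x)) (Set.Icc (-1) 1) := hB1.sub hB2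
  have key := intervalIntegral.integral_eq_sub_of_hasDerivAt_of_le (by norm_num) hGc hGd
    ((intervalIntegrable_iff_integrableOn_Icc_of_le (by norm_num)).2 (hA.add hB12))
  rw [intervalIntegral.integral_of_le (by norm_num), ← integral_Icc_eq_integral_Ioc,
    integral_add hA hB12, integral_sub hB1 hB2, integral_const_mul,
    integral_const_mul] at key
  simp only [hG] at key
  norm_num at key
  linarith

/-- A function which is continuous on a strip and `C¹` in time for positive times is Lipschitz
at any fixed positive time, uniformly in space. -/
lemma exists_abs_sub_le_mul_sub {T t : ℝ} (ht : t ∈ Set.Ioc 0 T) {K : Set ℝ} (hK : IsCompact K)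
    {U Ut : ℝ → ℝ → ℝ} (hU : ContinuousOn (fun p : ℝ × ℝ => U p.1 p.2) (Set.Icc 0 T ×ˢ K))
    (hUt : ∀ x ∈ K, ∀ t ∈ Set.Ioc (0 : ℝ) T,
      HasDerivWithinAt (fun s => U s x) (Ut t x) (Set.Icc 0 T) t)
    (hUtcont : ContinuousOn (fun p : ℝ × ℝ => Ut p.1 p.2) (Set.Ioc 0 T ×ˢ K)) :
    ∃ C, ∀ s ∈ Set.Icc 0 t, ∀ x ∈ K, |U t x - U s x| ≤ C * (t - s) := by
  have ht0 := ht.1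
  obtain ⟨M, hM⟩ := (isCompact_Icc.prod hK).exists_bound_of_continuousOn hU
  have hsub : Set.Icc (t / 2) t ⊆ Set.Ioc 0 T := fun s hs =>
    ⟨(half_pos ht0).trans_le hs.1, hs.2.trans ht.2⟩
  obtain ⟨B, hB⟩ := (isCompact_Icc.prod hK).exists_bound_of_continuousOn
    (hUtcont.mono (Set.prod_mono_left hsub))
  refine ⟨max B (4 * M / t), fun s hs x hx => ?_⟩
  have hd : 0 ≤ t - s := sub_nonneg.2 hs.2
  rcases le_total (t / 2) s with h | h
  · have := Convex.norm_image_sub_le_of_norm_hasDerivWithin_le (f := fun s => U s x)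
      (f' := fun s => Ut s x) (s := Set.Icc (t / 2) t) (C := B)
      (fun r hr => (hUt x hx r (hsub hr)).mono fun q hq =>
        Set.Ioc_subset_Icc_self (hsub hq))
      (fun r hr => hB (r, x) ⟨hr, hx⟩) (convex_Icc _ _) ⟨h, hs.2⟩ ⟨by linarith, le_rfl⟩
    rw [Real.norm_eq_abs, Real.norm_of_nonneg hd] at this
    exact this.trans (by gcongr; exact le_max_left _ _)
  · have h1 := hM (t, x) ⟨⟨ht0.le, ht.2⟩, hx⟩
    have h2 := hM (s, x) ⟨⟨hs.1, hs.2.trans ht.2⟩, hx⟩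
    simp only [Real.norm_eq_abs] at h1 h2
    have hM0 : 0 ≤ M := (abs_nonneg _).trans h1
    calc |U t x - U s x| ≤ |U t x| + |U s x| := abs_sub _ _
      _ ≤ 4 * M / t * (t / 2) := by
        have : 4 * M / t * (t / 2) = 2 * M := by field_simp; ring
        linarith
      _ ≤ 4 * M / t * (t - s) := by gcongr; linarith
      _ ≤ max B (4 * M / t) * (t - s) := by gcongr; exact le_max_right _ _

/-- Spatial moments commute with the Marchaud integral. -/
lemma integral_pow_mul_marchaud {α t C : ℝ} (hα1 : α < 1) (ht : 0 < t) {U : ℝ → ℝ → ℝ}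
    (hU : ContinuousOn (fun p : ℝ × ℝ => U p.1 p.2) (Set.Icc 0 t ×ˢ Set.Icc (-1) 1))
    (hC : ∀ s ∈ Set.Icc 0 t, ∀ x ∈ Set.Icc (-1 : ℝ) 1, |U t x - U s x| ≤ C * (t - s)) (k : ℕ) :
    IntegrableOn (fun x => x ^ k * ∫ s in Set.Ioo 0 t, (U t x - U s x) * (t - s) ^ (-α - 1))
      (Set.Icc (-1) 1) ∧
    ∫ x in Set.Icc (-1 : ℝ) 1,
        x ^ k * ∫ s in Set.Ioo 0 t, (U t x - U s x) * (t - s) ^ (-α - 1)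
      = ∫ s in Set.Ioo 0 t, ((∫ x in Set.Icc (-1 : ℝ) 1, x ^ k * U t x)
          - ∫ x in Set.Icc (-1 : ℝ) 1, x ^ k * U s x) * (t - s) ^ (-α - 1) := by
  have hslice : ∀ s ∈ Set.Icc 0 t, ContinuousOn (U s) (Set.Icc (-1) 1) := fun s hs =>
    hU.comp (f := fun x => (s, x)) (by fun_prop) fun x hx => ⟨hs, hx⟩
  have htmem : t ∈ Set.Icc 0 t := ⟨ht.le, le_rfl⟩
  set F : ℝ → ℝ → ℝ := fun x s => x ^ k * ((U t x - U s x) * (t - s) ^ (-α - 1)) with hF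
  have hFint : Integrable (Function.uncurry F)
      ((volume.restrict (Set.Icc (-1 : ℝ) 1)).prod (volume.restrict (Set.Ioo 0 t))) := by
    have hbound : Integrable (fun z : ℝ × ℝ => C * (t - z.2) ^ (-α))
        ((volume.restrict (Set.Icc (-1 : ℝ) 1)).prod (volume.restrict (Set.Ioo 0 t))) :=
      (integrable_const C).mul_prod (integrableOn_sub_rpow_neg hα1 ht)
    have hmeas := (measurableSet_Icc (a := (-1 : ℝ)) (b := 1)).prod
      (measurableSet_Ioo (a := (0 : ℝ)) (b := t))
    refine hbound.mono' ?_ ?_ <;> rw [Measure.prod_restrict]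
    · refine ContinuousOn.aestronglyMeasurable ?_ hmeas
      refine ContinuousOn.mul (by fun_prop) (ContinuousOn.mul (ContinuousOn.sub ?_ ?_) ?_)
      · exact (hslice t htmem).comp continuousOn_fst fun z hz => hz.1
      · exact hU.comp (f := fun z : ℝ × ℝ => (z.2, z.1)) (by fun_prop) fun z hz =>
          ⟨Set.Ioo_subset_Icc_self hz.2, hz.1⟩
      · exact ContinuousOn.rpow_const (by fun_prop) fun z hz =>
          Or.inl (sub_pos.2 hz.2.2).ne'
    · filter_upwards [ae_restrict_mem hmeas] with z hz
      have h1 := abs_mul_rpow_neg_sub_one_le (α := α) (sub_pos.2 hz.2.2)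
        (hC z.2 (Set.Ioo_subset_Icc_self hz.2) z.1 hz.1)
      have h2 : |z.1 ^ k| ≤ 1 := by
        rw [abs_pow]
        exact pow_le_one₀ (abs_nonneg _) (abs_le.2 hz.1)
      simp only [Function.uncurry, hF, Real.norm_eq_abs]
      rw [abs_mul]
      exact (mul_le_of_le_one_left (abs_nonneg _) h2).trans h1
  constructor
  · have := hFint.integral_prod_left
    simpa only [Function.uncurry, hF, integral_const_mul, IntegrableOn] using this
  · have := integral_integral_swap hFint
    simp only [hF, integral_const_mul] at this
    rw [this]
    refine setIntegral_congr_fun measurableSet_Ioo fun s hs => ?_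
    have hs' := Set.Ioo_subset_Icc_self hs
    have hi : ∀ s ∈ Set.Icc 0 t, IntegrableOn (fun x => x ^ k * U s x) (Set.Icc (-1) 1) :=
      fun s hs => ContinuousOn.integrableOn_Icc
        ((continuous_pow k).continuousOn.mul (hslice s hs))
    rw [← integral_sub (hi t htmem) (hi s hs'), ← integral_mul_const]
    congr 1 with x
    ring

theorem degenerate_inverse_problem_uniqueness (α T : ℝ)
    (hα0 : 0 < α) (hα1 : α < 1) (hT : 0 < T)
    (U Ut Ux Uxx : ℝ → ℝ → ℝ) (h : ℝ → ℝ)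
    (hUcont : ContinuousOn (fun p : ℝ × ℝ => U p.1 p.2) (Set.Icc 0 T ×ˢ Set.Icc (-1) 1))
    (hhcont : ContinuousOn h (Set.Icc (-1) 1))
    -- for each x, t ↦ U(t,x) is continuously differentiable on (0,T]
    (hUt : ∀ x ∈ Set.Icc (-1 : ℝ) 1, ∀ t ∈ Set.Ioc (0 : ℝ) T,
      HasDerivWithinAt (fun s => U s x) (Ut t x) (Set.Icc 0 T) t)
    (hUtcont : ContinuousOn (fun p : ℝ × ℝ => Ut p.1 p.2) (Set.Ioc 0 T ×ˢ Set.Icc (-1) 1))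
    -- U is twice continuously differentiable in x on [0,T] × [−1,1]
    (hUx : ∀ t ∈ Set.Icc (0 : ℝ) T, ∀ x ∈ Set.Icc (-1 : ℝ) 1,
      HasDerivWithinAt (fun y => U t y) (Ux t x) (Set.Icc (-1) 1) x)
    (hUxx : ∀ t ∈ Set.Icc (0 : ℝ) T, ∀ x ∈ Set.Icc (-1 : ℝ) 1,
      HasDerivWithinAt (fun y => Ux t y) (Uxx t x) (Set.Icc (-1) 1) x)
    (hUxcont : ContinuousOn (fun p : ℝ × ℝ => Ux p.1 p.2) (Set.Icc 0 T ×ˢ Set.Icc (-1) 1))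
    (hUxxcont : ContinuousOn (fun p : ℝ × ℝ => Uxx p.1 p.2) (Set.Icc 0 T ×ˢ Set.Icc (-1) 1))
    -- integrability of s ↦ ∂ₛU(s,x)(t−s)^{−α} on (0,t)
    (hint : ∀ t ∈ Set.Ioc (0 : ℝ) T, ∀ x ∈ Set.Ioo (-1 : ℝ) 1,
      IntegrableOn (fun s : ℝ => Ut s x * (t - s) ^ (-α)) (Set.Ioo 0 t))
    -- the equation: ᶜD₀ₜᵅ U = ∂ₓ[(1−x²)∂ₓU] + h(x)
    (heq : ∀ t ∈ Set.Ioc (0 : ℝ) T, ∀ x ∈ Set.Ioo (-1 : ℝ) 1,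
      (1 / Real.Gamma (1 - α)) * (∫ s in Set.Ioo 0 t, Ut s x * (t - s) ^ (-α))
        = deriv (fun y => (1 - y ^ 2) * Ux t y) x + h x)
    (hU0 : ∀ x ∈ Set.Icc (-1 : ℝ) 1, U 0 x = 0)
    (hUT : ∀ x ∈ Set.Icc (-1 : ℝ) 1, U T x = 0) :
    (∀ t ∈ Set.Icc (0 : ℝ) T, ∀ x ∈ Set.Icc (-1 : ℝ) 1, U t x = 0) ∧
    (∀ x ∈ Set.Icc (-1 : ℝ) 1, h x = 0) := by
  have hΓ : 0 < Real.Gamma (1 - α) := Real.Gamma_pos_of_pos (by linarith)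
  set Γ := Real.Gamma (1 - α)
  have hslice : ∀ V : ℝ → ℝ → ℝ, ContinuousOn (fun p : ℝ × ℝ => V p.1 p.2)
      (Set.Icc 0 T ×ˢ Set.Icc (-1) 1) → ∀ t ∈ Set.Icc 0 T, ContinuousOn (V t) (Set.Icc (-1) 1) :=
    fun V hV t ht => hV.comp (f := fun x => (t, x)) (by fun_prop) fun x hx => ⟨ht, hx⟩
  set m : ℕ → ℝ → ℝ := fun k t => ∫ x in Set.Icc (-1 : ℝ) 1, x ^ k * U t x with hm
  set c : ℕ → ℝ := fun k => ∫ x in Set.Icc (-1 : ℝ) 1, x ^ k * h x with hc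
  have hmcont : ∀ k, ContinuousOn (m k) (Set.Icc 0 T) := by
    intro k
    obtain ⟨M, hM⟩ := (isCompact_Icc.prod isCompact_Icc).exists_bound_of_continuousOn hUcont
    refine continuousOn_of_dominated (bound := fun _ => M) (fun t ht => ?_) (fun t ht => ?_)
      (integrable_const M) ?_
    · exact ((continuous_pow k).continuousOn.mul
        (hslice U hUcont t ht)).aestronglyMeasurable measurableSet_Icc
    · filter_upwards [ae_restrict_mem measurableSet_Icc] with x hx
      have h1 := hM (t, x) ⟨ht, hx⟩
      have h2 : ‖x ^ k‖ ≤ 1 := by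
        rw [norm_pow]
        exact pow_le_one₀ (norm_nonneg _) (abs_le.2 hx)
      rw [norm_mul]
      exact (mul_le_of_le_one_left (norm_nonneg _) h2).trans h1
    · filter_upwards [ae_restrict_mem measurableSet_Icc] with x hx
      exact continuousOn_const.mul (hUcont.comp (f := fun t => (t, x)) (by fun_prop)
        fun t ht => ⟨ht, hx⟩)
  have hm0 : ∀ k, m k 0 = 0 := fun k => by
    rw [hm]
    exact setIntegral_eq_zero_of_forall_eq_zero fun x hx => by simp [hU0 x hx]
  have hmT : ∀ k, m k T = 0 := fun k => by
    rw [hm]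
    exact setIntegral_eq_zero_of_forall_eq_zero fun x hx => by simp [hUT x hx]
  have hmeq : ∀ k, ∀ t ∈ Set.Ioc 0 T,
      m k t * t ^ (-α) + α * ∫ s in Set.Ioo 0 t, (m k t - m k s) * (t - s) ^ (-α - 1)
        = Γ * (-(k * (k + 1)) * m k t + k * (k - 1) * m (k - 2) t + c k) := by
    intro k t ht
    have htI := Set.Ioc_subset_Icc_self ht
    have hsubT : Set.Icc 0 t ⊆ Set.Icc 0 T := Set.Icc_subset_Icc_right ht.2
    obtain ⟨C, hC⟩ := exists_abs_sub_le_mul_sub ht isCompact_Icc hUcont hUt hUtcont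
    obtain ⟨hI, hswap⟩ := integral_pow_mul_marchaud (α := α) hα1 ht.1
      (hUcont.mono (Set.prod_mono_left hsubT)) hC k
    have hUc := hslice U hUcont t htI
    have hUxc := hslice Ux hUxcont t htI
    have hUxxc := hslice Uxx hUxxcont t htI
    have hL := integral_pow_mul_legendre (hUx t htI) (hUxx t htI) hUxxc k
    have hpoint : ∀ x ∈ Set.Ioo (-1 : ℝ) 1,
        t ^ (-α) * (x ^ k * U t x)
          + α * (x ^ k * ∫ s in Set.Ioo 0 t, (U t x - U s x) * (t - s) ^ (-α - 1))
        = Γ * (x ^ k * ((1 - x ^ 2) * Uxx t x - 2 * x * Ux t x) + x ^ k * h x) := by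
      intro x hx
      have hxI := Set.Ioo_subset_Icc_self hx
      have hcap := integral_deriv_mul_rpow_eq_marchaud hα1 ht.1 (f := fun s => U s x)
        (f' := fun s => Ut s x) (C := C)
        (hUcont.comp (f := fun s => (s, x)) (by fun_prop) fun s hs => ⟨hsubT hs, hxI⟩)
        (fun s hs => (hUt x hxI s ⟨hs.1, hs.2.le.trans ht.2⟩).hasDerivAt
          (Icc_mem_nhds hs.1 (hs.2.trans_le ht.2)))
        (fun s hs => hC s hs x hxI) (hint t ht x hx)
      have hder : HasDerivAt (fun y => (1 - y ^ 2) * Ux t y)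
          ((1 - x ^ 2) * Uxx t x - 2 * x * Ux t x) x := by
        have h3 : HasDerivAt (fun x : ℝ => 1 - x ^ 2) (-(2 * x)) x := by
          simpa using (hasDerivAt_pow 2 x).const_sub 1
        refine (h3.mul ((hUxx t htI x hxI).hasDerivAt (Icc_mem_nhds hx.1 hx.2))).congr_deriv ?_
        ring
      have he := heq t ht x hx
      rw [hder.deriv, hcap, hU0 x hxI, one_div, inv_mul_eq_iff_eq_mul₀ hΓ.ne'] at he
      linear_combination x ^ k * he
    have hiU : IntegrableOn (fun x => x ^ k * U t x) (Set.Icc (-1) 1) :=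
      ContinuousOn.integrableOn_Icc (by fun_prop)
    have hiL : IntegrableOn (fun x => x ^ k * ((1 - x ^ 2) * Uxx t x - 2 * x * Ux t x))
      (Set.Icc (-1) 1) := ContinuousOn.integrableOn_Icc (by fun_prop)
    have hih : IntegrableOn (fun x => x ^ k * h x) (Set.Icc (-1) 1) :=
      ContinuousOn.integrableOn_Icc (by fun_prop)
    have key := setIntegral_congr_fun (μ := volume) measurableSet_Ioo hpoint
    rw [← integral_Icc_eq_integral_Ioo, ← integral_Icc_eq_integral_Ioo,
      integral_add (hiU.const_mul _) (hI.const_mul _), integral_const_mul, integral_const_mul,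
      integral_const_mul, integral_add hiL hih, hswap, hL] at key
    rw [mul_comm (m k t)]
    exact key
  have hmain : ∀ k, (∀ t ∈ Set.Icc 0 T, m k t = 0) ∧ c k = 0 := by
    intro k
    induction k using Nat.strong_induction_on with
    | _ k ih =>
      have hlower : ∀ t ∈ Set.Icc 0 T, (k : ℝ) * (k - 1) * m (k - 2) t = 0 := by
        intro t ht
        rcases k with _ | _ | k
        · simp
        · simp
        · rw [(ih (k + 2 - 2) (by omega)).1 t ht, mul_zero]
      have hres := eq_zero_of_marchaud_relaxation hα0 hT (lam := Γ * (k * (k + 1)))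
        (c := Γ * c k) (by positivity) (hmcont k) (hm0 k) (hmT k) fun t ht => by
          rw [hmeq k t ht, hlower t (Set.Ioc_subset_Icc_self ht)]
          ring
      exact ⟨hres.1, (mul_eq_zero.1 hres.2).resolve_left hΓ.ne'⟩
  exact ⟨fun t ht => eq_zero_of_forall_moment_eq_zero (by norm_num) (hslice U hUcont t ht)
      fun k => (hmain k).1 t ht,
    eq_zero_of_forall_moment_eq_zero (by norm_num) hhcont fun k => (hmain k).2⟩
end

section
/- Let 0 < α < 1, T > 0, and w₀, w₂ ∈ ℝ, and assume E_α(−6T^α) ≠ 1. Define U(t,x) = w₀ (t/T)^α + w₂ · ((1 − E_α(−6 t^α))/(1 − E_α(−6 T^α))) · (3x² − 1) and h(x) = w₀ Γ(α+1)/T^α + 6 w₂ (3x² − 1)/(1 − E_α(−6 T^α)). Then for every (t,x) ∈ (0,T] × (−1,1) the Caputo fractional derivative of order α of t ↦ U(t,x) exists and (1/Γ(1−α)) ∫_0^t ∂_sU(s,x)(t−s)^{−α} ds = ∂_x[(1 − x²) ∂_xU(t,x)] + h(x); moreover U(0,x) = 0 and U(T,x) = w₀ + w₂(3x² − 1) for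 all x ∈ [−1,1]. -/
open MeasureTheory

section MittagLeffler

open Set Real

/-- Lower bound for the Gamma function from the part of its integral beyond `R`. -/
lemma rpow_mul_exp_neg_le_Gamma {R s : ℝ} (hR : 0 < R) (hs : 0 ≤ s) :
    R ^ s * exp (-R) ≤ Gamma (s + 1) := by
  have hconv := GammaIntegral_convergent (s := s + 1) (by linarith)
  rw [Gamma_eq_integral (by linarith), ← integral_exp_neg_Ioi R, ← integral_const_mul]
  have hsub : Ioi R ⊆ Ioi (0 : ℝ) := Ioi_subset_Ioi hR.le
  calc ∫ x in Ioi R, R ^ s * exp (-x)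
      ≤ ∫ x in Ioi R, exp (-x) * x ^ (s + 1 - 1) := by
        refine setIntegral_mono_on ((integrableOn_exp_neg_Ioi R).const_mul _)
          (hconv.mono_set hsub) measurableSet_Ioi fun x hx => ?_
        rw [add_sub_cancel_right, mul_comm]
        gcongr
        exact le_of_lt hx
    _ ≤ ∫ x in Ioi 0, exp (-x) * x ^ (s + 1 - 1) := by
        refine setIntegral_mono_set hconv ?_ hsub.eventuallyLE
        filter_upwards [ae_restrict_mem measurableSet_Ioi] with x hx
        have : 0 < x := hx
        simp only [Pi.zero_apply]
        positivity

lemma inv_Gamma_le {R s : ℝ} (hR : 0 < R) (hs : 0 < s) :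
    (Gamma s)⁻¹ ≤ s * (exp R * R ^ (-s)) := by
  have h := rpow_mul_exp_neg_le_Gamma hR hs.le
  rw [Gamma_add_one hs.ne', exp_neg] at h
  have hG := Gamma_pos_of_pos hs
  have hRs : 0 < R ^ s := rpow_pos_of_pos hR s
  rw [rpow_neg hR.le, inv_le_iff_one_le_mul₀ hG]
  have he := exp_pos R
  calc (1 : ℝ) = (R ^ s * (exp R)⁻¹) * (exp R * (R ^ s)⁻¹) := by field_simp
    _ ≤ (s * Gamma s) * (exp R * (R ^ s)⁻¹) := by gcongr
    _ = _ := by ring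

lemma summable_mlE {α β : ℝ} (hα : 0 < α) (hβ : 0 < β) (x : ℝ) :
    Summable fun k : ℕ => x ^ k / Gamma (α * k + β) := by
  set R : ℝ := (2 * |x| + 1) ^ α⁻¹ with hRdef
  have hR : 0 < R := by positivity
  have hRα : R ^ α = 2 * |x| + 1 := by
    rw [hRdef, ← rpow_mul (by positivity), inv_mul_cancel₀ hα.ne', rpow_one]
  set q : ℝ := |x| / (2 * |x| + 1) with hq
  have hq0 : 0 ≤ q := by positivity
  have hq1 : ‖q‖ < 1 := by
    rw [norm_of_nonneg hq0, hq, div_lt_one (by positivity)]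
    linarith [abs_nonneg x]
  have h0 : Summable fun k : ℕ => q ^ k := summable_geometric_of_norm_lt_one hq1
  have h1 : Summable fun k : ℕ => (k : ℝ) * q ^ k := by
    simpa using summable_pow_mul_geometric_of_norm_lt_one 1 hq1
  have hsum := ((h1.mul_left α).add (h0.mul_left β)).mul_left (exp R * R ^ (-β))
  refine Summable.of_norm_bounded hsum fun k => ?_
  have hs : 0 < α * k + β := by positivity
  have hG := Gamma_pos_of_pos hs
  rw [norm_div, norm_pow, norm_eq_abs, norm_of_nonneg hG.le, div_eq_mul_inv]
  refine (mul_le_mul_of_nonneg_left (inv_Gamma_le hR hs) (by positivity)).trans (le_of_eq ?_)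
  rw [neg_add, rpow_add hR, rpow_neg hR.le (α * k), rpow_mul hR.le, hRα, rpow_natCast, hq, div_pow]
  field_simp

lemma hasDerivAt_mlE {α β : ℝ} (hα : 0 < α) (hβ : 0 < β) (z : ℝ) :
    HasDerivAt (mlE α β) (∑' k : ℕ, k * z ^ (k - 1) / Gamma (α * k + β)) z := by
  set r : ℝ := |z| + 1 with hr
  have hr1 : 1 ≤ r := by linarith [abs_nonneg z]
  refine hasDerivAt_tsum_of_isPreconnected (t := Metric.ball 0 r) (y₀ := z)
    (summable_mlE hα hβ (2 * r)) Metric.isOpen_ball (convex_ball 0 r).isPreconnected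
    (fun k y _ => (hasDerivAt_pow k y).div_const _) (fun k y hy => ?_) ?_
    (summable_mlE hα hβ z) ?_
  · have hG : 0 < Gamma (α * k + β) := Gamma_pos_of_pos (by positivity)
    rw [mem_ball_zero_iff] at hy
    rw [norm_div, norm_of_nonneg hG.le, norm_mul, norm_pow, norm_natCast, mul_pow]
    gcongr
    · exact_mod_cast Nat.lt_two_pow_self.le
    · exact (pow_le_pow_left₀ (norm_nonneg y) hy.le _).trans
        (pow_le_pow_right₀ hr1 (Nat.sub_le k 1))
  all_goals simp [hr]

lemma tsum_deriv_mlE_one {α : ℝ} (hα : 0 < α) (z : ℝ) :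
    ∑' k : ℕ, k * z ^ (k - 1) / Gamma (α * k + 1) = mlE α α z / α := by
  have hterm (k : ℕ) : ((k + 1 : ℕ) : ℝ) * z ^ (k + 1 - 1) / Gamma (α * (k + 1 : ℕ) + 1)
      = z ^ k / Gamma (α * k + α) / α := by
    have hG : 0 < Gamma (α * k + α) := Gamma_pos_of_pos (by positivity)
    rw [Gamma_add_one (by positivity), Nat.add_sub_cancel,
      show α * ((k + 1 : ℕ) : ℝ) = α * k + α by push_cast; ring]
    push_cast
    field_simp
  rw [tsum_eq_zero_add' ?_]
  · simp_rw [hterm, tsum_div_const, mlE]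
    simp
  · simp_rw [hterm]
    exact (summable_mlE hα hα z).div_const α

lemma continuous_mlE {α β : ℝ} (hα : 0 < α) (hβ : 0 < β) : Continuous (mlE α β) :=
  continuous_iff_continuousAt.2 fun z => (hasDerivAt_mlE hα hβ z).continuousAt

lemma hasDerivAt_mlE_mul_rpow {α : ℝ} (hα : 0 < α) (c : ℝ) {s : ℝ} (hs : 0 < s) :
    HasDerivAt (fun τ => mlE α 1 (c * τ ^ α)) (c * (s ^ (α - 1) * mlE α α (c * s ^ α))) s := by
  have h := (hasDerivAt_mlE hα one_pos (c * s ^ α)).comp s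
    ((hasDerivAt_rpow_const (p := α) (Or.inl hs.ne')).const_mul c)
  rw [tsum_deriv_mlE_one hα] at h
  convert! h using 1
  field_simp

lemma mlE_one_zero (α : ℝ) : mlE α 1 0 = 1 := by
  rw [mlE, tsum_eq_single 0 fun k hk => by simp [hk]]
  simp

/-- Convergence of the real Beta integral over `(0, t)`. -/
lemma integrableOn_beta_scaled {p q t : ℝ} (hp : 0 < p) (hq : 0 < q) (ht : 0 < t) :
    IntegrableOn (fun s : ℝ => s ^ (p - 1) * (t - s) ^ (q - 1)) (Ioo 0 t) := by
  have h := (Complex.betaIntegral_convergent (u := p) (v := q) (by simpa) (by simpa)).norm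
  have h2 := (h.comp_mul_left (c := t⁻¹)).const_mul (t ^ (p - 1) * t ^ (q - 1))
  simp only [zero_div, one_div, inv_inv] at h2
  rw [intervalIntegrable_iff_integrableOn_Ioo_of_le ht.le] at h2
  refine h2.congr_fun (fun s hs => ?_) measurableSet_Ioo
  have hs0 : 0 < t⁻¹ * s := mul_pos (inv_pos.2 ht) hs.1
  have hs1 : 0 < 1 - t⁻¹ * s := by
    rw [inv_mul_eq_div, sub_pos, div_lt_one ht]; exact hs.2
  have e1 : t * (t⁻¹ * s) = s := by field_simp
  have e2 : t * (1 - t⁻¹ * s) = t - s := by field_simp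
  have n1 : ‖((t⁻¹ * s : ℝ) : ℂ) ^ ((p : ℂ) - 1)‖ = (t⁻¹ * s) ^ (p - 1) := by
    rw [Complex.norm_cpow_eq_rpow_re_of_pos hs0]; simp
  have n2 : ‖(1 - ((t⁻¹ * s : ℝ) : ℂ)) ^ ((q : ℂ) - 1)‖ = (1 - t⁻¹ * s) ^ (q - 1) := by
    rw [← Complex.ofReal_one, ← Complex.ofReal_sub, Complex.norm_cpow_eq_rpow_re_of_pos hs1]; simp
  simp only [norm_mul, n1, n2]
  rw [mul_mul_mul_comm, ← mul_rpow ht.le hs0.le, ← mul_rpow ht.le hs1.le, e1, e2]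

lemma integral_beta_scaled {p q t : ℝ} (hp : 0 < p) (hq : 0 < q) (ht : 0 < t) :
    ∫ s in Ioo 0 t, s ^ (p - 1) * (t - s) ^ (q - 1)
      = t ^ (p + q - 1) * (Gamma p * Gamma q / Gamma (p + q)) := by
  have h := Complex.betaIntegral_scaled p q ht
  rw [Complex.betaIntegral_eq_Gamma_mul_div _ _ (by simpa) (by simpa),
    intervalIntegral.integral_of_le ht.le, integral_Ioc_eq_integral_Ioo] at h
  rw [← Complex.ofReal_inj, ← integral_complex_ofReal]
  refine Eq.trans (setIntegral_congr_fun measurableSet_Ioo fun s hs => ?_) (h.trans ?_)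
  · have : 0 ≤ t - s := sub_nonneg.2 hs.2.le
    simp only [Complex.ofReal_mul, Complex.ofReal_cpow this, Complex.ofReal_cpow hs.1.le]
    push_cast
    rfl
  · rw [← Complex.ofReal_add, Complex.Gamma_ofReal, Complex.Gamma_ofReal, Complex.Gamma_ofReal,
      Complex.ofReal_mul, Complex.ofReal_cpow ht.le]
    push_cast
    rfl

/-- The kernel `s ^ (α - 1) * E_{α,α}(c * s ^ α) * (t - s) ^ (-α)` is integrable on `(0, t)`. -/
lemma integrableOn_mlE_kernel {α t : ℝ} (hα0 : 0 < α) (hα1 : α < 1) (ht : 0 < t) (c : ℝ) :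
    IntegrableOn (fun s => s ^ (α - 1) * mlE α α (c * s ^ α) * (t - s) ^ (-α)) (Ioo 0 t) := by
  have hbeta := integrableOn_beta_scaled hα0 (sub_pos.2 hα1) ht
  rw [← integrableOn_Icc_iff_integrableOn_Ioo] at hbeta ⊢
  have hcont : Continuous fun s : ℝ => mlE α α (c * s ^ α) :=
    (continuous_mlE hα0 hα0).comp (continuous_const.mul (continuous_rpow_const hα0.le))
  refine (hbeta.continuousOn_mul hcont.continuousOn isCompact_Icc).congr_fun
    (fun s _ => ?_) measurableSet_Icc
  simp only [sub_sub_cancel_left]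
  ring

lemma integral_mlE_kernel {α t : ℝ} (hα0 : 0 < α) (hα1 : α < 1) (ht : 0 < t) (c : ℝ) :
    ∫ s in Ioo 0 t, s ^ (α - 1) * mlE α α (c * s ^ α) * (t - s) ^ (-α)
      = Gamma (1 - α) * mlE α 1 (c * t ^ α) := by
  have hα1' : 0 < 1 - α := sub_pos.2 hα1
  have hpos (k : ℕ) : 0 < α * k + α := by positivity
  set B : ℕ → ℝ → ℝ := fun k s => s ^ (α * k + α - 1) * (t - s) ^ (1 - α - 1) with hB
  set F : ℕ → ℝ → ℝ := fun k s => c ^ k / Gamma (α * k + α) * B k s with hF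
  have hBint (k : ℕ) : Integrable (B k) (volume.restrict (Ioo 0 t)) :=
    integrableOn_beta_scaled (hpos k) hα1' ht
  have hval (d : ℝ) (k : ℕ) : d ^ k / Gamma (α * k + α) * ∫ s in Ioo 0 t, B k s
      = Gamma (1 - α) * ((d * t ^ α) ^ k / Gamma (α * k + 1)) := by
    have hG := Gamma_pos_of_pos (hpos k)
    rw [hB, integral_beta_scaled (hpos k) hα1' ht,
      show α * k + α + (1 - α) - 1 = α * k by ring,
      show α * k + α + (1 - α) = α * k + 1 by ring, rpow_mul ht.le, rpow_natCast, mul_pow]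
    field_simp
  have hnorm (k : ℕ) : ∫ s in Ioo 0 t, ‖F k s‖
      = Gamma (1 - α) * ((|c| * t ^ α) ^ k / Gamma (α * k + 1)) := by
    rw [← hval, ← integral_const_mul]
    refine setIntegral_congr_fun measurableSet_Ioo fun s hs => ?_
    have hBs : 0 ≤ B k s :=
      mul_nonneg (rpow_nonneg hs.1.le _) (rpow_nonneg (sub_nonneg.2 hs.2.le) _)
    simp only [hF, norm_mul, norm_div, norm_pow, norm_eq_abs, abs_of_nonneg hBs,
      abs_of_pos (Gamma_pos_of_pos (hpos k))]
  have hsum := hasSum_integral_of_summable_integral_norm (F := F)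
    (μ := volume.restrict (Ioo 0 t)) (fun k => (hBint k).const_mul _) (by
      simp_rw [hnorm]
      exact (summable_mlE hα0 one_pos _).mul_left _)
  have htsum : ∫ s in Ioo 0 t, ∑' k, F k s
      = ∫ s in Ioo 0 t, s ^ (α - 1) * mlE α α (c * s ^ α) * (t - s) ^ (-α) := by
    refine setIntegral_congr_fun measurableSet_Ioo fun s hs => ?_
    simp only [mlE]
    rw [← tsum_mul_left, ← tsum_mul_right]
    refine tsum_congr fun k => ?_
    simp only [hF, hB]
    rw [add_sub_assoc, rpow_add hs.1, rpow_mul hs.1.le, rpow_natCast, mul_pow, sub_sub_cancel_left]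
    ring
  rw [← htsum, ← hsum.tsum_eq]
  simp_rw [hF, integral_const_mul, hval, tsum_mul_left, mlE]

lemma deriv_one_sub_sq_mul_deriv (a b x : ℝ) :
    deriv (fun y => (1 - y ^ 2) * deriv (fun z => a + b * (3 * z ^ 2 - 1)) y) x
      = -6 * b * (3 * x ^ 2 - 1) := by
  have h1 (y : ℝ) : HasDerivAt (fun z => a + b * (3 * z ^ 2 - 1)) (b * (6 * y)) y := by
    refine (((((hasDerivAt_pow 2 y).const_mul 3).sub_const 1).const_mul b).const_add
      a).congr_deriv ?_
    push_cast
    ring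
  simp_rw [fun y => (h1 y).deriv]
  refine ((((hasDerivAt_pow 2 x).const_sub 1).mul
    (((hasDerivAt_id x).const_mul 6).const_mul b)).congr_deriv ?_).deriv
  push_cast
  simp only [id]
  ring

end MittagLeffler

theorem example_solution_space_degenerate (α T w0 w2 : ℝ)
    (hα0 : 0 < α) (hα1 : α < 1) (hT : 0 < T)
    (hE : mlE α 1 (-6 * T ^ α) ≠ 1) :
    let U : ℝ → ℝ → ℝ := fun t x =>
      w0 * (t / T) ^ α +
        w2 * ((1 - mlE α 1 (-6 * t ^ α)) / (1 - mlE α 1 (-6 * T ^ α))) * (3 * x ^ 2 - 1)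
    let h : ℝ → ℝ := fun x =>
      w0 * Real.Gamma (α + 1) / T ^ α +
        6 * w2 * (3 * x ^ 2 - 1) / (1 - mlE α 1 (-6 * T ^ α))
    (∀ t ∈ Set.Ioc (0 : ℝ) T, ∀ x ∈ Set.Ioo (-1 : ℝ) 1,
        DifferentiableOn ℝ (fun s => U s x) (Set.Ioo 0 t) ∧
        IntegrableOn (fun s : ℝ => deriv (fun τ => U τ x) s * (t - s) ^ (-α)) (Set.Ioo 0 t) ∧
        (1 / Real.Gamma (1 - α)) *
            (∫ s in Set.Ioo 0 t, deriv (fun τ => U τ x) s * (t - s) ^ (-α))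
          = deriv (fun y => (1 - y ^ 2) * deriv (fun z => U t z) y) x + h x) ∧
    (∀ x ∈ Set.Icc (-1 : ℝ) 1, U 0 x = 0 ∧ U T x = w0 + w2 * (3 * x ^ 2 - 1)) := by
  intro U h
  have hD : 1 - mlE α 1 (-6 * T ^ α) ≠ 0 := sub_ne_zero.2 hE.symm
  refine ⟨fun t ht x _ => ?_, fun x _ => ⟨?_, ?_⟩⟩
  · have ht0 : 0 < t := ht.1
    set P : ℝ := w0 * α / T ^ α with hP
    set Q : ℝ := 6 * w2 * (3 * x ^ 2 - 1) / (1 - mlE α 1 (-6 * T ^ α)) with hQ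
    have hder (s : ℝ) (hs : 0 < s) : HasDerivAt (fun τ => U τ x)
        (P * s ^ (α - 1) + Q * (s ^ (α - 1) * mlE α α (-6 * s ^ α))) s := by
      have hpow : HasDerivAt (fun τ : ℝ => w0 * (τ / T) ^ α) (P * s ^ (α - 1)) s := by
        refine ((((hasDerivAt_id s).div_const T).rpow_const
          (Or.inl (div_pos hs hT).ne')).const_mul w0).congr_deriv ?_
        rw [id, Real.div_rpow hs.le hT.le, Real.rpow_sub_one hT.ne', hP]
        field_simp
      refine (hpow.add ((((hasDerivAt_mlE_mul_rpow hα0 (-6) hs).const_sub 1).div_const _).const_mul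
        w2 |>.mul_const (3 * x ^ 2 - 1))).congr_deriv ?_
      rw [hQ]
      ring
    have hcongr : Set.EqOn (fun s => P * (s ^ (α - 1) * (t - s) ^ (1 - α - 1))
          + Q * (s ^ (α - 1) * mlE α α (-6 * s ^ α) * (t - s) ^ (-α)))
        (fun s => deriv (fun τ => U τ x) s * (t - s) ^ (-α)) (Set.Ioo 0 t) := fun s hs => by
      simp only [(hder s hs.1).deriv, sub_sub_cancel_left]
      ring
    have hbeta := (integrableOn_beta_scaled hα0 (sub_pos.2 hα1) ht0).const_mul P
    have hkernel := (integrableOn_mlE_kernel hα0 hα1 ht0 (-6)).const_mul Q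
    refine ⟨fun s hs => (hder s hs.1).differentiableAt.differentiableWithinAt,
      IntegrableOn.congr_fun (hbeta.add hkernel) hcongr measurableSet_Ioo, ?_⟩
    have hG : Real.Gamma (1 - α) ≠ 0 := (Real.Gamma_pos_of_pos (sub_pos.2 hα1)).ne'
    rw [← setIntegral_congr_fun measurableSet_Ioo hcongr, integral_add hbeta hkernel,
      integral_const_mul, integral_const_mul, integral_mlE_kernel hα0 hα1 ht0,
      integral_beta_scaled hα0 (sub_pos.2 hα1) ht0, deriv_one_sub_sq_mul_deriv, add_sub_cancel,
      sub_self, Real.rpow_zero, Real.Gamma_one]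
    simp only [h, hP, hQ]
    rw [Real.Gamma_add_one hα0.ne']
    field_simp
    ring
  · simp [U, Real.zero_rpow hα0.ne', mlE_one_zero]
  · simp only [U, div_self hT.ne', div_self hD, Real.one_rpow, mul_one]
end
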